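/- arXiv:1811.01351 — 3 statements merged into one kernel-verified Lean document; each statement's English description precedes it below -/
import Mathlib

section
/- For every natural number n, every indexed set Q of polynomials on n pairs of twin variables, every cut-off function c for Q, every real s ≥ 1 and all positive integers w and d: if there is a multilinear PS refutation from Q of product-width at most w with at most s explicit monomials of degree at least d (counted with multiplicity), then there is a PS refutation from Q of product-width at most w and degree mod c at most 2d' + 2d'', where d' = d + ⌊2(n+1)·log(s)/d⌋ and d'' = max{1, ⌈(max c)/2⌉}, and log denotes the natural logarithm. -/
open MvPolynomial

noncomputable section

/-- The polynomial ring in `n` pairs of twin variables: `Sum.inl i` is the basic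
variable `xᵢ` and `Sum.inr i` is its twin `x̄ᵢ`. -/
abbrev MvPoly (n : ℕ) : Type := MvPolynomial (Fin n ⊕ Fin n) ℝ

/-- The Boolean axioms `xᵢ² − xᵢ`, `x̄ᵢ² − x̄ᵢ` and `xᵢ + x̄ᵢ − 1`. -/
def boolAxiom (n : ℕ) (a : Fin 3 × Fin n) : MvPoly n :=
  if a.1 = 0 then X (Sum.inl a.2) ^ 2 - X (Sum.inl a.2)
  else if a.1 = 1 then X (Sum.inr a.2) ^ 2 - X (Sum.inr a.2)
  else X (Sum.inl a.2) + X (Sum.inr a.2) - 1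

/-- The sum of squares of a list of polynomials. -/
def sosOf {n : ℕ} (l : List (MvPoly n)) : MvPoly n := (l.map (· ^ 2)).sum

/-- A Positivstellensatz proof of `goal ≥ 0` from the inequality constraints
`q j ≥ 0` (`j : Fin ℓ`) and the equality constraints `p j = 0` (`j : Fin m`),
on `n` pairs of twin variables. -/
structure PSProof (n ℓ m : ℕ) (q : Fin ℓ → MvPoly n) (p : Fin m → MvPoly n)
    (goal : MvPoly n) : Type where
  Js : Finset (Finset (Fin ℓ))
  empty_not_mem : ∅ ∉ Js
  r0 : List (MvPoly n)
  r : Finset (Fin ℓ) → List (MvPoly n)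
  t : Fin m → MvPoly n
  u : Fin 3 × Fin n → MvPoly n
  identity : goal = sosOf r0 + ∑ J ∈ Js, sosOf (r J) * ∏ j ∈ J, q j
      + ∑ j, t j * p j + ∑ a, u a * boolAxiom n a

namespace PSProof

variable {n ℓ m : ℕ} {q : Fin ℓ → MvPoly n} {p : Fin m → MvPoly n} {goal : MvPoly n}

/-- The proof has product-width at most `w`. -/
def widthLE (π : PSProof n ℓ m q p goal) (w : ℕ) : Prop := ∀ J ∈ π.Js, J.card ≤ w

/-- The proof has degree at most `d` (the zero polynomial having degree `−∞`). -/
def degreeLE (π : PSProof n ℓ m q p goal) (d : ℕ) : Prop :=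
  goal.totalDegree ≤ d ∧ (sosOf π.r0).totalDegree ≤ d ∧
  (∀ J ∈ π.Js, sosOf (π.r J) ≠ 0 →
    (sosOf (π.r J)).totalDegree + ∑ j ∈ J, (q j).totalDegree ≤ d) ∧
  (∀ j, π.t j ≠ 0 → (π.t j).totalDegree + (p j).totalDegree ≤ d)

/-- The monomial size of the proof: the total number of monomials of the `r` and `t`
polynomials. -/
def size (π : PSProof n ℓ m q p goal) : ℕ :=
  (π.r0.map fun r => r.support.card).sum
  + ∑ J ∈ π.Js, ((π.r J).map fun r => r.support.card).sum
  + ∑ j, (π.t j).support.card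

end PSProof

/-- A cut-off function for the system `q, p`. -/
def IsCutoff {n ℓ m : ℕ} (q : Fin ℓ → MvPoly n) (p : Fin m → MvPoly n)
    (c : Finset (Fin ℓ) ⊕ Fin m → ℕ) : Prop :=
  (∀ J : Finset (Fin ℓ), ∑ j ∈ J, (q j).totalDegree ≤ c (Sum.inl J)) ∧
  (∀ j : Fin m, (p j).totalDegree ≤ c (Sum.inr j))

/-- The proof has degree mod `c` at most `d`. -/
def PSProof.degreeModLE {n ℓ m : ℕ} {q : Fin ℓ → MvPoly n} {p : Fin m → MvPoly n}
    {goal : MvPoly n} (π : PSProof n ℓ m q p goal)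
    (c : Finset (Fin ℓ) ⊕ Fin m → ℕ) (d : ℕ) : Prop :=
  goal.totalDegree ≤ d ∧ (sosOf π.r0).totalDegree ≤ d ∧
  (∀ J ∈ π.Js, sosOf (π.r J) ≠ 0 → (sosOf (π.r J)).totalDegree + c (Sum.inl J) ≤ d) ∧
  (∀ j, π.t j ≠ 0 → (π.t j).totalDegree + c (Sum.inr j) ≤ d)

/-- `PS^c_{w,d}(Q)`: polynomials of degree at most `d` with a PS proof of
degree mod `c` at most `d` and product-width at most `w`.  `Q ⊢^c_{w,d} a ≥ b`
is expressed as `a - b ∈ PScone …`. -/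
def PScone (n ℓ m : ℕ) (q : Fin ℓ → MvPoly n) (p : Fin m → MvPoly n)
    (c : Finset (Fin ℓ) ⊕ Fin m → ℕ) (w d : ℕ) : Set (MvPoly n) :=
  {g | g.totalDegree ≤ d ∧ ∃ π : PSProof n ℓ m q p g, π.degreeModLE c d ∧ π.widthLE w}

/-- `ℰ^c_{w,d}(Q)`: pseudo-expectations, i.e. linear functionals on the space of
polynomials of degree at most `d` sending `1` to `1` and the cone to nonnegatives. -/
def PseudoExp (n ℓ m : ℕ) (q : Fin ℓ → MvPoly n) (p : Fin m → MvPoly n)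
    (c : Finset (Fin ℓ) ⊕ Fin m → ℕ) (w d : ℕ) :
    Set ((restrictTotalDegree (Fin n ⊕ Fin n) ℝ d) →ₗ[ℝ] ℝ) :=
  {E | (∀ g : restrictTotalDegree (Fin n ⊕ Fin n) ℝ d, (g : MvPoly n) = 1 → E g = 1) ∧
    (∀ g : restrictTotalDegree (Fin n ⊕ Fin n) ℝ d,
      (g : MvPoly n) ∈ PScone n ℓ m q p c w d → 0 ≤ E g)}

/-- A polynomial is multilinear if no variable occurs with exponent `≥ 2`. -/
def IsMultilinearPoly {n : ℕ} (r : MvPoly n) : Prop :=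
  ∀ α ∈ r.support, ∀ v, α v ≤ 1

/-- A PS proof is multilinear if all the `r` and `t` polynomials are multilinear. -/
def PSProof.Multilinear {n ℓ m : ℕ} {q : Fin ℓ → MvPoly n} {p : Fin m → MvPoly n}
    {goal : MvPoly n} (π : PSProof n ℓ m q p goal) : Prop :=
  (∀ r ∈ π.r0, IsMultilinearPoly r) ∧
  (∀ J ∈ π.Js, ∀ r ∈ π.r J, IsMultilinearPoly r) ∧
  (∀ j, IsMultilinearPoly (π.t j))

/-- The number of explicit monomials of the proof of degree at least `d`,
counted with multiplicity. -/
def PSProof.tallMonCount {n ℓ m : ℕ} {q : Fin ℓ → MvPoly n} {p : Fin m → MvPoly n}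
    {goal : MvPoly n} (π : PSProof n ℓ m q p goal) (d : ℕ) : ℕ :=
  (π.r0.map fun r => ((r.support.filter fun α => d ≤ α.sum fun _ e => e).card)).sum
  + ∑ J ∈ π.Js,
      ((π.r J).map fun r => ((r.support.filter fun α => d ≤ α.sum fun _ e => e).card)).sum
  + ∑ j, ((π.t j).support.filter fun α => d ≤ α.sum fun _ e => e).card

namespace PSDR

/-- The point of the cube. -/
def ptv {n : ℕ} (a : Fin n → Bool) : Fin n ⊕ Fin n → ℝ :=
  Sum.elim (fun i => if a i then 1 else 0) (fun i => if a i then 0 else 1)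

/-- The index of a literal. -/
def var {n : ℕ} (v : Fin n ⊕ Fin n) : Fin n := Sum.elim id id v

lemma ptv_01 {n : ℕ} (a : Fin n → Bool) (v) : ptv a v = 0 ∨ ptv a v = 1 := by
  rcases v with i | i <;> simp only [ptv, Sum.elim_inl, Sum.elim_inr] <;> split_ifs <;> simp

lemma ptv_swap {n : ℕ} (a : Fin n → Bool) (v) : ptv a v.swap = 1 - ptv a v := by
  rcases v with i | i <;> simp [ptv] <;> split_ifs <;> simp

lemma ptv_update_ne {n : ℕ} (a : Fin n → Bool) (i b v) (h : var v ≠ i) :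
    ptv (Function.update a i b) v = ptv a v := by
  rcases v with j | j <;> simp [var] at h <;> simp [ptv, Function.update_of_ne h]

lemma exists_val {n : ℕ} (v : Fin n ⊕ Fin n) :
    ∃ b, ∀ a : Fin n → Bool, ptv (Function.update a (var v) b) v = 0 := by
  rcases v with j | j
  · exact ⟨false, fun a => by simp [ptv, var]⟩
  · exact ⟨true, fun a => by simp [ptv, var]⟩

lemma var_swap {n : ℕ} (v : Fin n ⊕ Fin n) : var v.swap = var v := by
  rcases v with j | j <;> rfl

lemma eq_or_swap {n : ℕ} {v z : Fin n ⊕ Fin n} (h : var v = var z) : v = z ∨ v = z.swap := by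
  rcases v with j | j <;> rcases z with k | k <;> simp_all [var]

/-- Cube Nullstellensatz. -/
def delta {n : ℕ} (a : Fin n → Bool) : MvPoly n :=
  ∏ i, (if a i then X (Sum.inl i) else X (Sum.inr i))

lemma ax0 {n : ℕ} (i : Fin n) : (X (Sum.inl i) ^ 2 - X (Sum.inl i) : MvPoly n) ∈
    Ideal.span (Set.range (boolAxiom n)) :=
  Ideal.subset_span ⟨(0, i), by simp [boolAxiom]⟩

lemma ax1 {n : ℕ} (i : Fin n) : (X (Sum.inr i) ^ 2 - X (Sum.inr i) : MvPoly n) ∈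
    Ideal.span (Set.range (boolAxiom n)) :=
  Ideal.subset_span ⟨(1, i), by simp [boolAxiom]⟩

lemma ax2 {n : ℕ} (i : Fin n) : (X (Sum.inl i) + X (Sum.inr i) - 1 : MvPoly n) ∈
    Ideal.span (Set.range (boolAxiom n)) :=
  Ideal.subset_span ⟨(2, i), by simp [boolAxiom]⟩

lemma X_delta {n : ℕ} (a : Fin n → Bool) (v) :
    (X v * delta a - C (ptv a v) * delta a : MvPoly n) ∈ Ideal.span (Set.range (boolAxiom n)) := by
  have key : ∃ e, delta a = (if a (var v) then X (Sum.inl (var v)) else X (Sum.inr (var v))) * e :=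
    ⟨_, (Finset.mul_prod_erase _ _ (Finset.mem_univ (var v))).symm⟩
  obtain ⟨e, he⟩ := key
  rw [he]
  rcases v with i | i <;> simp only [var, ptv, Sum.elim_inl, Sum.elim_inr, id] <;>
    by_cases hi : a i = true <;> simp only [hi, if_true, if_false, map_one, map_zero,
      Bool.false_eq_true]
  · have := Ideal.mul_mem_left _ e (ax0 i)
    convert this using 1; ring
  · have := Ideal.mul_mem_left _ e (sub_mem (Ideal.mul_mem_left _ (X (Sum.inl i)) (ax2 i)) (ax0 i))
    convert this using 1; ring
  · have := Ideal.mul_mem_left _ e (sub_mem (Ideal.mul_mem_left _ (X (Sum.inl i)) (ax2 i)) (ax0 i))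
    convert this using 1; ring
  · have := Ideal.mul_mem_left _ e (ax1 i)
    convert this using 1; ring

lemma poly_delta {n : ℕ} (a : Fin n → Bool) (G : MvPoly n) :
    (G * delta a - C (eval (ptv a) G) * delta a : MvPoly n) ∈
      Ideal.span (Set.range (boolAxiom n)) := by
  induction G using MvPolynomial.induction_on with
  | C r => simp
  | add f g hf hg =>
    convert add_mem hf hg using 1
    simp only [map_add]; ring
  | mul_X f v hf =>
    convert add_mem (Ideal.mul_mem_left _ (X v) hf)
      (Ideal.mul_mem_left _ (C (eval (ptv a) f)) (X_delta a v)) using 1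
    simp only [map_mul, eval_X]; ring

lemma sum_delta {n : ℕ} : (∑ a : Fin n → Bool, delta a - 1 : MvPoly n) ∈
    Ideal.span (Set.range (boolAxiom n)) := by
  have h : (∑ a : Fin n → Bool, delta a : MvPoly n)
      = ∏ i : Fin n, (X (Sum.inl i) + X (Sum.inr i)) := by
    have := Finset.prod_univ_sum (fun _ : Fin n => (Finset.univ : Finset Bool))
      (fun i b => (if b then X (Sum.inl i) else X (Sum.inr i) : MvPoly n))
    simp only [Fintype.piFinset_univ] at this
    simp only [delta]
    rw [← this]
    simp
  rw [h, ← Ideal.Quotient.eq, map_prod, map_one]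
  apply Finset.prod_eq_one
  intro i _
  rw [← map_one (Ideal.Quotient.mk _), Ideal.Quotient.eq]
  exact ax2 i

lemma cube_null {n : ℕ} (G : MvPoly n) (hG : ∀ a, eval (ptv a) G = 0) :
    ∃ u : Fin 3 × Fin n → MvPoly n, G = ∑ a, u a * boolAxiom n a := by
  have h1 : G ∈ Ideal.span (Set.range (boolAxiom n)) := by
    have h2 : G * ∑ a, delta a ∈ Ideal.span (Set.range (boolAxiom n)) := by
      rw [Finset.mul_sum]
      refine sum_mem fun a _ => ?_
      simpa [hG a] using poly_delta a G
    have := sub_mem h2 (Ideal.mul_mem_left _ G (sum_delta (n := n)))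
    convert this using 1; ring
  obtain ⟨u, hu⟩ := Ideal.mem_span_range_iff_exists_fun.1 h1
  exact ⟨u, hu.symm⟩

section
variable {n ℓ m : ℕ}

/-- The explicit part of a proof. -/
def expr (q : Fin ℓ → MvPoly n) (p : Fin m → MvPoly n)
    (L : List (MvPoly n × Finset (Fin ℓ))) (t : Fin m → MvPoly n) : MvPoly n :=
  (L.map fun x => x.1 ^ 2 * ∏ j ∈ x.2, q j).sum + ∑ j, t j * p j

/-- The cut-off, adjusted at the empty set. -/
def cut (c : Finset (Fin ℓ) ⊕ Fin m → ℕ) (J : Finset (Fin ℓ)) : ℕ :=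
  if J = ∅ then 0 else c (Sum.inl J)

/-- The cone of functions on `A` provable in degree `D`. -/
def Cone (q : Fin ℓ → MvPoly n) (p : Fin m → MvPoly n) (c : Finset (Fin ℓ) ⊕ Fin m → ℕ)
    (w : ℕ) (A : Set (Fin n → Bool)) (D : ℕ) (h : (Fin n → Bool) → ℝ) : Prop :=
  ∃ (L : List (MvPoly n × Finset (Fin ℓ))) (t : Fin m → MvPoly n),
    (∀ x ∈ L, x.2.card ≤ w ∧ 2 * x.1.totalDegree + cut c x.2 ≤ D) ∧
    (∀ j, (t j).totalDegree + c (Sum.inr j) ≤ D) ∧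
    ∀ a ∈ A, h a = eval (ptv a) (expr q p L t)

variable {q : Fin ℓ → MvPoly n} {p : Fin m → MvPoly n} {c : Finset (Fin ℓ) ⊕ Fin m → ℕ}
  {w : ℕ} {A : Set (Fin n → Bool)} {D : ℕ}

lemma expr_append (L L' : List (MvPoly n × Finset (Fin ℓ))) (t t' : Fin m → MvPoly n) :
    expr q p (L ++ L') (t + t') = expr q p L t + expr q p L' t' := by
  simp [expr, add_mul, Finset.sum_add_distrib]; ring

lemma expr_mul (f : MvPoly n) (L : List (MvPoly n × Finset (Fin ℓ))) (t : Fin m → MvPoly n) :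
    expr q p (L.map fun x => (f * x.1, x.2)) (fun j => f ^ 2 * t j) = f ^ 2 * expr q p L t := by
  simp only [expr, List.map_map, mul_add, Finset.mul_sum, ← List.sum_map_mul_left]
  congr 1
  · congr 1; apply List.map_congr_left; intro x _; simp; ring
  · refine Finset.sum_congr rfl fun j _ => by ring

lemma Cone.add {h h' : (Fin n → Bool) → ℝ} (H : Cone q p c w A D h) (H' : Cone q p c w A D h') :
    Cone q p c w A D (fun a => h a + h' a) := by
  obtain ⟨L, t, h1, h2, h3⟩ := H
  obtain ⟨L', t', h1', h2', h3'⟩ := H'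
  refine ⟨L ++ L', t + t', ?_, ?_, ?_⟩
  · intro x hx
    rcases List.mem_append.1 hx with hx | hx
    exacts [h1 x hx, h1' x hx]
  · intro j
    have := totalDegree_add (t j) (t' j)
    have h4 := h2 j
    have h5 := h2' j
    simp only [Pi.add_apply]
    rcases le_max_iff.1 this with h | h <;> omega
  · intro a ha
    simp only [expr_append, map_add, h3 a ha, h3' a ha]

lemma Cone.mulsq {B : Set (Fin n → Bool)} (f : MvPoly n) {h : (Fin n → Bool) → ℝ}
    (H : Cone q p c w B D h) (hB : ∀ a ∈ A, eval (ptv a) f = 0 ∨ a ∈ B) :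
    Cone q p c w A (D + 2 * f.totalDegree) (fun a => eval (ptv a) f ^ 2 * h a) := by
  obtain ⟨L, t, h1, h2, h3⟩ := H
  refine ⟨L.map fun x => (f * x.1, x.2), fun j => f ^ 2 * t j, ?_, ?_, ?_⟩
  · intro x hx
    obtain ⟨y, hy, rfl⟩ := List.mem_map.1 hx
    have := totalDegree_mul f y.1
    have h4 := h1 y hy
    refine ⟨h4.1, ?_⟩
    have := h4.2
    dsimp only
    omega
  · intro j
    have := totalDegree_mul (f ^ 2) (t j)
    have := totalDegree_pow f 2
    have := h2 j
    dsimp only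
    omega
  · intro a ha
    rw [expr_mul, map_mul, map_pow]
    rcases hB a ha with h0 | h0
    · simp [h0]
    · simp only [h3 a h0]

lemma Cone.smul {h : (Fin n → Bool) → ℝ} (H : Cone q p c w A D h) {k : ℝ} (hk : 0 ≤ k) :
    Cone q p c w A D (fun a => k * h a) := by
  have := H.mulsq (A := A) (C (Real.sqrt k)) (fun a ha => Or.inr ha)
  simpa [Real.sq_sqrt hk] using this

lemma Cone.congr {h h' : (Fin n → Bool) → ℝ} (H : Cone q p c w A D h)
    (hh : ∀ a ∈ A, h' a = h a) : Cone q p c w A D h' := by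
  obtain ⟨L, t, h1, h2, h3⟩ := H
  exact ⟨L, t, h1, h2, fun a ha => (hh a ha).trans (h3 a ha)⟩

lemma Cone.sq (hD : ∀ j, c (Sum.inr j) ≤ D) (f : MvPoly n) (hf : 2 * f.totalDegree ≤ D) :
    Cone q p c w A D (fun a => eval (ptv a) f ^ 2) := by
  refine ⟨[(f, ∅)], 0, ?_, ?_, ?_⟩
  · simp [cut, hf]
  · simpa using hD
  · simp [expr]

lemma Cone.const (hD : ∀ j, c (Sum.inr j) ≤ D) {k : ℝ} (hk : 0 ≤ k) :
    Cone q p c w A D (fun _ => k) := by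
  refine (Cone.sq hD (C (Real.sqrt k)) (by simp)).congr fun a _ => ?_
  simp [Real.sq_sqrt hk]

lemma expr_deg (hc : IsCutoff q p c) (L : List (MvPoly n × Finset (Fin ℓ)))
    (t : Fin m → MvPoly n)
    (h1 : ∀ x ∈ L, x.2.card ≤ w ∧ 2 * x.1.totalDegree + cut c x.2 ≤ D)
    (h2 : ∀ j, (t j).totalDegree + c (Sum.inr j) ≤ D) :
    (expr q p L t).totalDegree ≤ D := by
  refine (totalDegree_add _ _).trans (max_le ?_ ?_)
  · induction L with
    | nil => simp
    | cons x L ih =>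
      rw [List.map_cons, List.sum_cons]
      refine (totalDegree_add _ _).trans (max_le ?_ ?_)
      · have h3 := totalDegree_mul (x.1 ^ 2) (∏ j ∈ x.2, q j)
        have h4 := totalDegree_pow x.1 2
        have h5 : (∏ j ∈ x.2, q j).totalDegree ≤ _ := totalDegree_finsetProd x.2 q
        have h6 := (h1 x (by simp)).2
        have h7 : ∑ j ∈ x.2, (q j).totalDegree ≤ cut c x.2 := by
          unfold cut
          split_ifs with h
          · simp [h]
          · exact hc.1 _
        omega
      · exact ih fun y hy => h1 y (by simp [hy])
  · refine totalDegree_finsetSum_le fun j _ => ?_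
    have := totalDegree_mul (t j) (p j)
    have := h2 j
    have := hc.2 j
    omega

/-- Almost in the cone. -/
def AC (q : Fin ℓ → MvPoly n) (p : Fin m → MvPoly n) (c : Finset (Fin ℓ) ⊕ Fin m → ℕ)
    (w : ℕ) (A : Set (Fin n → Bool)) (D : ℕ) (h : (Fin n → Bool) → ℝ) : Prop :=
  ∀ δ : ℝ, 0 < δ → Cone q p c w A D (fun a => h a + δ)

lemma AC.add {h h' : (Fin n → Bool) → ℝ} (H : AC q p c w A D h) (H' : AC q p c w A D h') :
    AC q p c w A D (fun a => h a + h' a) := by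
  intro δ hδ
  refine ((H (δ / 2) (by positivity)).add (H' (δ / 2) (by positivity))).congr fun a _ => ?_
  ring

lemma AC.zero (hD : ∀ j, c (Sum.inr j) ≤ D) : AC q p c w A D (fun _ => 0) := by
  intro δ hδ
  refine (Cone.const hD hδ.le).congr fun a _ => by ring

lemma AC.smul (hD : ∀ j, c (Sum.inr j) ≤ D) {h : (Fin n → Bool) → ℝ} (H : AC q p c w A D h)
    {k : ℝ} (hk : 0 ≤ k) : AC q p c w A D (fun a => k * h a) := by
  rcases hk.eq_or_lt with rfl | hk
  · simpa using AC.zero hD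
  · intro δ hδ
    refine ((H (δ / k) (by positivity)).smul hk.le).congr fun a _ => ?_
    field_simp

lemma AC.sum (hD : ∀ j, c (Sum.inr j) ≤ D) {ι : Type*} (s : Finset ι)
    (h : ι → (Fin n → Bool) → ℝ) (H : ∀ i ∈ s, AC q p c w A D (h i)) :
    AC q p c w A D (fun a => ∑ i ∈ s, h i a) := by
  classical
  induction s using Finset.induction_on with
  | empty => simpa using AC.zero hD
  | insert i s hi ih =>
    simp only [Finset.sum_insert hi]
    exact (H i (by simp)).add (ih fun j hj => H j (by simp [hj]))

lemma exists_split {σ : Type*} (β : σ →₀ ℕ) (k : ℕ) (hk : k ≤ β.degree) :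
    ∃ β1 β2 : σ →₀ ℕ, β = β1 + β2 ∧ β1.degree = k := by
  classical
  induction k with
  | zero => exact ⟨0, β, by simp, by simp⟩
  | succ k ih =>
    obtain ⟨β1, β2, h, h1⟩ := ih (by omega)
    have : β2 ≠ 0 := by
      rintro rfl
      simp at h; subst h; omega
    obtain ⟨v, hv⟩ := Finsupp.ne_iff.1 this
    refine ⟨β1 + Finsupp.single v 1, β2 - Finsupp.single v 1, ?_, by simp [h1]⟩
    rw [h, add_assoc, add_tsub_cancel_of_le]
    simpa [Nat.one_le_iff_ne_zero] using hv

lemma mon_01 (a : Fin n → Bool) (β : Fin n ⊕ Fin n →₀ ℕ) :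
    eval (ptv a) (monomial β (1 : ℝ)) = 0 ∨ eval (ptv a) (monomial β (1 : ℝ)) = 1 := by
  rw [eval_monomial, one_mul, Finsupp.prod]
  by_cases h : ∃ v ∈ β.support, ptv a v = 0
  · obtain ⟨v, hv, h⟩ := h
    left
    refine Finset.prod_eq_zero hv ?_
    rw [h, zero_pow (by simpa using hv)]
  · right
    push Not at h
    refine Finset.prod_eq_one fun v hv => ?_
    rw [(ptv_01 a v).resolve_left (h v hv), one_pow]

lemma AC_mon (hD : ∀ j, c (Sum.inr j) ≤ 2 * D) (hD1 : 1 ≤ D) (z : Fin n ⊕ Fin n)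
    (hz : Cone q p c w A (2 * D) (fun a => -ptv a z)) (β : Fin n ⊕ Fin n →₀ ℕ)
    (hβ : β.degree + 1 ≤ 2 * D) (σ : ℝ) (hσ : σ ^ 2 = 1) :
    AC q p c w A (2 * D) (fun a => σ * (ptv a z * eval (ptv a) (monomial β (1 : ℝ)))) := by
  intro δ hδ
  obtain ⟨β1, β2, rfl, h1⟩ := exists_split β (min β.degree (D - 1)) (min_le_left _ _)
  have hdeg : (β1 + β2).degree = β1.degree + β2.degree := by simp
  have hb1 : β1.degree + 1 ≤ D := by omega
  have hb2 : β2.degree ≤ D := by omega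
  set P : MvPoly n := monomial β1 1 with hP
  set Q : MvPoly n := monomial β2 1 with hQ
  have hPd : P.totalDegree = β1.degree := totalDegree_monomial _ one_ne_zero
  have hQd : Q.totalDegree = β2.degree := totalDegree_monomial _ one_ne_zero
  have hPQ : monomial (β1 + β2) (1 : ℝ) = P * Q := by rw [hP, hQ, monomial_mul, one_mul]
  set e := Real.sqrt (2 * δ) with he
  have he0 : 0 < e := Real.sqrt_pos.2 (by positivity)
  have he2 : e ^ 2 = 2 * δ := Real.sq_sqrt (by positivity)
  have hXP : (X z * P : MvPoly n).totalDegree ≤ D := by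
    have := totalDegree_mul (X z) P
    rw [totalDegree_X] at this; omega
  have hC : ∀ (k : ℝ) (f : MvPoly n), f.totalDegree ≤ D → (C k * f).totalDegree ≤ D := by
    intro k f hf
    have := totalDegree_mul (C k) f
    rw [totalDegree_C] at this; omega
  have c1 := (Cone.sq (q := q) (p := p) (w := w) (A := A) hD
    (C e * Q + C (σ / e) * (X z * P)) (by
      have := totalDegree_add (C e * Q) (C (σ / e) * (X z * P))
      have := max_le (hC e Q (by omega)) (hC (σ / e) _ hXP)
      omega)).smul (k := 1 / 2) (by norm_num)
  have c2 := (Cone.sq (q := q) (p := p) (w := w) (A := A) hD (1 - Q) (by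
      have := totalDegree_sub (1 : MvPoly n) Q
      rw [totalDegree_one] at this
      omega)).smul (k := δ) hδ.le
  have c3 := (Cone.sq (q := q) (p := p) (w := w) (A := A) hD (X z - X z * P) (by
      have := totalDegree_sub (X z : MvPoly n) (X z * P)
      rw [totalDegree_X] at this
      omega)).smul (k := 1 / (4 * δ)) (by positivity)
  have c4 := hz.smul (k := 1 / (4 * δ)) (by positivity)
  refine (((c1.add c2).add c3).add c4).congr fun a _ => ?_
  rw [hPQ]
  simp only [map_add, map_sub, map_mul, eval_C, eval_X, map_one]
  have i1 : 1 / (4 * δ) = 1 / (2 * e ^ 2) := by rw [he2]; ring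
  have i2 : δ = e ^ 2 / 2 := by rw [he2]; ring
  rw [i1, i2]
  rcases ptv_01 a z with h1 | h1 <;> rcases mon_01 a β1 with h2 | h2 <;>
    rcases mon_01 a β2 with h3 | h3 <;> rw [← hP] at h2 <;> rw [← hQ] at h3 <;>
    rw [h1, h2, h3] <;> field_simp <;> (try ring_nf) <;> (try rw [hσ]) <;> (try ring_nf)

lemma mon_upd (a : Fin n → Bool) (i : Fin n) (b : Bool) (β : Fin n ⊕ Fin n →₀ ℕ)
    (h : ∀ v ∈ β.support, var v ≠ i) :
    eval (ptv (Function.update a i b)) (monomial β (1 : ℝ)) = eval (ptv a) (monomial β 1) := by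
  simp only [eval_monomial, Finsupp.prod]
  congr 1
  exact Finset.prod_congr rfl fun v hv => by rw [ptv_update_ne _ _ _ _ (h v hv)]

lemma mon_split (v : Fin n ⊕ Fin n) (α : Fin n ⊕ Fin n →₀ ℕ) (r : ℝ) :
    monomial α r = X v ^ (α v) * monomial (α.erase v) r := by
  rw [X_pow_eq_monomial, monomial_mul, one_mul, Finsupp.single_add_erase]

lemma pow_01 {x : ℝ} (hx : x = 0 ∨ x = 1) {k : ℕ} (hk : k ≠ 0) : x ^ k = x := by
  rcases hx with rfl | rfl <;> simp [hk]

lemma diff_mon (z : Fin n ⊕ Fin n) (b : Bool)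
    (hb : ∀ a : Fin n → Bool, ptv (Function.update a (var z) b) z = 0)
    (α : Fin n ⊕ Fin n →₀ ℕ) :
    ∃ β : Fin n ⊕ Fin n →₀ ℕ, ∃ σ κ : ℝ, σ ^ 2 = 1 ∧ 0 ≤ κ ∧ (κ ≠ 0 → β.degree + 1 ≤ α.degree) ∧
      ∀ a, eval (ptv a) (monomial α (1 : ℝ))
        - eval (ptv (Function.update a (var z) b)) (monomial α (1 : ℝ))
        = κ * (σ * (ptv a z * eval (ptv a) (monomial β (1 : ℝ)))) := by
  have hdeg : ∀ v, α v ≠ 0 → (α.erase v).degree + 1 ≤ α.degree := by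
    intro v hv
    have h1 := congrArg Finsupp.degree (Finsupp.single_add_erase v α)
    rw [map_add, Finsupp.degree_single] at h1
    omega
  by_cases h1 : α z = 0
  · by_cases h2 : α z.swap = 0
    · refine ⟨0, 1, 0, by norm_num, le_rfl, by simp, fun a => ?_⟩
      rw [mon_upd, sub_self, zero_mul]
      intro v hv hvz
      rcases eq_or_swap hvz with rfl | rfl <;> simp_all
    · refine ⟨α.erase z.swap, -1, 1, by norm_num, by norm_num, fun _ => hdeg _ h2, fun a => ?_⟩
      rw [mon_split z.swap α, map_mul, map_mul, map_pow, map_pow, eval_X, eval_X,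
        pow_01 (ptv_01 _ _) h2, pow_01 (ptv_01 _ _) h2, ptv_swap, ptv_swap, hb, mon_upd]
      · ring
      · intro v hv hvz
        rcases eq_or_swap hvz with rfl | rfl <;> simp_all
  · refine ⟨α.erase z, 1, 1, by norm_num, by norm_num, fun _ => hdeg _ h1, fun a => ?_⟩
    rw [mon_split z α, map_mul, map_mul, map_pow, map_pow, eval_X, eval_X,
        pow_01 (ptv_01 _ _) h1, pow_01 (ptv_01 _ _) h1, hb]
    ring

lemma eval_as_sum (a : Fin n → Bool) (G : MvPoly n) :
    eval (ptv a) G = ∑ α ∈ G.support, coeff α G * eval (ptv a) (monomial α (1 : ℝ)) := by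
  conv_lhs => rw [G.as_sum, map_sum]
  refine Finset.sum_congr rfl fun α _ => ?_
  simp [eval_monomial]

lemma combine (hc : IsCutoff q p c) (hD : ∀ j, c (Sum.inr j) ≤ 2 * D) (hD1 : 1 ≤ D)
    (z : Fin n ⊕ Fin n) (hfree : ∀ a ∈ A, ∀ b, Function.update a (var z) b ∈ A)
    (hz : Cone q p c w A (2 * D) (fun a => -ptv a z))
    (H1 : Cone q p c w (A ∩ {a | ptv a z = 0}) (2 * D) (fun _ => -1)) :
    Cone q p c w A (2 * D) (fun _ => -1) := by
  obtain ⟨b, hb⟩ := exists_val z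
  obtain ⟨L, t, h1, h2, h3⟩ := H1
  set G : MvPoly n := -1 - expr q p L t with hG
  have hGd : G.totalDegree ≤ 2 * D := by
    refine (totalDegree_sub _ _).trans (max_le ?_ (expr_deg hc L t h1 h2))
    rw [totalDegree_neg, totalDegree_one]; omega
  have hE : Cone q p c w A (2 * D) (fun a => eval (ptv a) (expr q p L t)) :=
    ⟨L, t, h1, h2, fun a _ => rfl⟩
  have hAC : AC q p c w A (2 * D) (fun a => ∑ α ∈ G.support, coeff α G *
      (eval (ptv a) (monomial α (1 : ℝ))
        - eval (ptv (Function.update a (var z) b)) (monomial α (1 : ℝ)))) := by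
    refine AC.sum hD _ _ fun α hα => ?_
    obtain ⟨β, σ, κ, hσ, hκ, hdeg, hψ⟩ := diff_mon z b hb α
    simp only [hψ]
    rcases eq_or_ne κ 0 with rfl | hκ0
    · simpa using AC.zero hD
    have hβ : β.degree + 1 ≤ 2 * D := (hdeg hκ0).trans ((le_totalDegree hα).trans hGd)
    rcases le_total 0 (coeff α G) with hs | hs
    · have := (AC_mon hD hD1 z hz β hβ σ hσ).smul hD (mul_nonneg hs hκ)
      simpa only [mul_assoc] using this
    · have := (AC_mon hD hD1 z hz β hβ (-σ) (by simpa using hσ)).smul hD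
        (mul_nonneg (neg_nonneg.2 hs) hκ)
      convert this using 2
      ring
  have := (hE.add (hAC (1 / 2) (by norm_num))).smul (k := 2) (by norm_num)
  refine this.congr fun a ha => ?_
  simp only [mul_sub, Finset.sum_sub_distrib]
  rw [← eval_as_sum, ← eval_as_sum]
  have h4 : eval (ptv (Function.update a (var z) b)) G = 0 := by
    have := h3 _ ⟨hfree a ha b, hb a⟩
    rw [hG, map_sub, map_neg, map_one, ← this]; ring
  rw [h4, hG]
  simp only [map_sub, map_neg, map_one]
  ring

/-- Restriction of a polynomial by the literal `y := 0`. -/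
def restr (y : Fin n ⊕ Fin n) (r : MvPoly n) : MvPoly n :=
  ∑ α ∈ r.support, if α y = 0 then monomial (α.erase y.swap) (coeff α r) else 0

lemma eval_restr (y : Fin n ⊕ Fin n) (r : MvPoly n) (a : Fin n → Bool) (ha : ptv a y = 0) :
    eval (ptv a) (restr y r) = eval (ptv a) r := by
  conv_rhs => rw [r.as_sum, map_sum]
  rw [restr, map_sum]
  refine Finset.sum_congr rfl fun α _ => ?_
  split_ifs with h
  · rw [mon_split y.swap α, map_mul, map_pow, eval_X, ptv_swap, ha]; simp
  · rw [mon_split y α, map_mul, map_pow, eval_X, ha]; simp [h]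

lemma mem_restr (y : Fin n ⊕ Fin n) (r : MvPoly n) {β} (hβ : β ∈ (restr y r).support) :
    ∃ α ∈ r.support, α y = 0 ∧ β = α.erase y.swap := by
  rw [mem_support_iff, restr, coeff_sum] at hβ
  obtain ⟨α, hα, h⟩ := Finset.exists_ne_zero_of_sum_ne_zero hβ
  split_ifs at h with h0
  · refine ⟨α, hα, h0, ?_⟩
    rw [coeff_monomial] at h
    by_contra hne
    exact h (if_neg (Ne.symm hne))
  · simp at h

/-- Number of tall monomials. -/
def tc (d : ℕ) (r : MvPoly n) : ℕ := (r.support.filter fun α => d ≤ α.sum fun _ e => e).card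

/-- Number of tall monomials containing `y`. -/
def tcy (d : ℕ) (y : Fin n ⊕ Fin n) (r : MvPoly n) : ℕ :=
  ((r.support.filter fun α => d ≤ α.sum fun _ e => e).filter fun α => ¬ α y = 0).card

lemma tc_restr (d : ℕ) (y : Fin n ⊕ Fin n) (r : MvPoly n) :
    tc d (restr y r) + tcy d y r ≤ tc d r := by
  classical
  have h := Finset.card_filter_add_card_filter_not
    (s := r.support.filter fun α => d ≤ α.sum fun _ e => e) (fun α => α y = 0)
  have h2 : tc d (restr y r) ≤
      ((r.support.filter fun α => d ≤ α.sum fun _ e => e).filter fun α => α y = 0).card := by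
    refine le_trans (Finset.card_le_card ?_) (Finset.card_image_le (f := fun α => α.erase y.swap))
    intro β hβ
    rw [Finset.mem_filter] at hβ
    obtain ⟨α, hα, h0, rfl⟩ := mem_restr y r hβ.1
    refine Finset.mem_image.2 ⟨α, ?_, rfl⟩
    simp only [Finset.mem_filter]
    refine ⟨⟨hα, hβ.2.trans ?_⟩, h0⟩
    have h1 : (Finsupp.single y.swap (α y.swap) + α.erase y.swap).degree = α.degree :=
      congrArg Finsupp.degree (Finsupp.single_add_erase y.swap α)
    rw [map_add, Finsupp.degree_single] at h1
    change (α.erase y.swap).degree ≤ α.degree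
    omega
  unfold tcy
  unfold tc at h2 ⊢
  omega

/-- Multilinear with all variables in `F`. -/
def Good (F : Finset (Fin n)) (r : MvPoly n) : Prop :=
  ∀ α ∈ r.support, ∀ v, α v ≤ 1 ∧ (α v ≠ 0 → var v ∈ F)

lemma Good.restr {F : Finset (Fin n)} {r : MvPoly n} (h : Good F r) (y : Fin n ⊕ Fin n) :
    Good (F.erase (var y)) (restr y r) := by
  intro β hβ v
  obtain ⟨α, hα, h0, rfl⟩ := mem_restr y r hβ
  by_cases hv : v = y.swap
  · simp [hv]
  · rw [Finsupp.erase_ne hv]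
    refine ⟨(h α hα v).1, fun hne => Finset.mem_erase.2 ⟨fun he => ?_, (h α hα v).2 hne⟩⟩
    rcases eq_or_swap he with rfl | h'
    · exact hne h0
    · exact hv h'

lemma Good.avg {F : Finset (Fin n)} {r : MvPoly n} (h : Good F r) (d : ℕ) :
    d * tc d r ≤ ∑ y, tcy d y r := by
  classical
  simp only [tcy, Finset.card_filter _ (r.support.filter _)]
  rw [Finset.sum_comm, mul_comm, tc, ← smul_eq_mul]
  refine Finset.card_nsmul_le_sum _ _ _ fun α hα => ?_
  rw [Finset.mem_filter] at hα
  refine hα.2.trans ?_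
  rw [Finsupp.sum_fintype _ _ (fun _ => rfl)]
  refine Finset.sum_le_sum fun v _ => ?_
  have := (h α hα.1 v).1
  split_ifs <;> omega

/-- Total of a weight over the explicit polynomials. -/
def tot (L : List (MvPoly n × Finset (Fin ℓ))) (t : Fin m → MvPoly n) (φ : MvPoly n → ℕ) : ℕ :=
  (L.map fun x => φ x.1).sum + ∑ j, φ (t j)

lemma tot_mono (L : List (MvPoly n × Finset (Fin ℓ))) (t : Fin m → MvPoly n)
    (φ ψ : MvPoly n → ℕ) (h1 : ∀ x ∈ L, φ x.1 ≤ ψ x.1) (h2 : ∀ j, φ (t j) ≤ ψ (t j)) :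
    tot L t φ ≤ tot L t ψ :=
  add_le_add (List.sum_le_sum h1) (Finset.sum_le_sum fun j _ => h2 j)

lemma tot_add (L : List (MvPoly n × Finset (Fin ℓ))) (t : Fin m → MvPoly n)
    (φ ψ : MvPoly n → ℕ) : tot L t (fun r => φ r + ψ r) = tot L t φ + tot L t ψ := by
  simp only [tot, List.sum_map_add, Finset.sum_add_distrib]; ring

lemma tot_mul (L : List (MvPoly n × Finset (Fin ℓ))) (t : Fin m → MvPoly n) (k : ℕ)
    (φ : MvPoly n → ℕ) : tot L t (fun r => k * φ r) = k * tot L t φ := by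
  simp only [tot, List.sum_map_mul_left, ← Finset.mul_sum]; ring

lemma tot_sum {ι : Type*} (s : Finset ι) (L : List (MvPoly n × Finset (Fin ℓ)))
    (t : Fin m → MvPoly n)
    (φ : ι → MvPoly n → ℕ) : tot L t (fun r => ∑ i ∈ s, φ i r) = ∑ i ∈ s, tot L t (φ i) := by
  classical
  induction s using Finset.induction_on with
  | empty => simp [tot]
  | insert i s hi ih => simp only [Finset.sum_insert hi, tot_add, ih]

lemma tot_eq_zero {L : List (MvPoly n × Finset (Fin ℓ))} {t : Fin m → MvPoly n}
    {φ : MvPoly n → ℕ} (h : tot L t φ = 0) : (∀ x ∈ L, φ x.1 = 0) ∧ ∀ j, φ (t j) = 0 := by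
  simp only [tot, Nat.add_eq_zero_iff, List.sum_eq_zero_iff, Finset.sum_eq_zero_iff] at h
  exact ⟨fun x hx => h.1 _ (List.mem_map.2 ⟨x, hx, rfl⟩), fun j => h.2 j (Finset.mem_univ _)⟩

lemma deg_of_tc {d : ℕ} (hd : 0 < d) {r : MvPoly n} (h : tc d r = 0) : r.totalDegree ≤ d - 1 := by
  refine Finset.sup_le fun α hα => ?_
  rw [tc, Finset.card_eq_zero, Finset.filter_eq_empty_iff] at h
  have := h hα
  omega

/-- The restricted proof. -/
lemma expr_restr (y : Fin n ⊕ Fin n) (L : List (MvPoly n × Finset (Fin ℓ)))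
    (t : Fin m → MvPoly n) (a : Fin n → Bool) (ha : ptv a y = 0) :
    eval (ptv a) (expr q p (L.map fun x => (restr y x.1, x.2)) (fun j => restr y (t j)))
      = eval (ptv a) (expr q p L t) := by
  simp only [expr, map_add, map_sum, map_mul, eval_restr y _ a ha, map_list_sum, List.map_map]
  congr 2
  apply List.map_congr_left
  intro x _
  simp [eval_restr y _ a ha]

lemma tot_restr (y : Fin n ⊕ Fin n) (d : ℕ) (L : List (MvPoly n × Finset (Fin ℓ)))
    (t : Fin m → MvPoly n) :
    tot (L.map fun x => (restr y x.1, x.2)) (fun j => restr y (t j)) (tc d) + tot L t (tcy d y)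
      ≤ tot L t (tc d) := by
  have : tot (L.map fun x => (restr y x.1, x.2)) (fun j => restr y (t j)) (tc d)
      = tot L t (fun r => tc d (restr y r)) := by
    simp only [tot, List.map_map]; rfl
  rw [this, ← tot_add]
  exact tot_mono _ _ _ _ (fun x _ => tc_restr _ _ _) (fun j => tc_restr _ _ _)

set_option maxHeartbeats 1000000 in
lemma main (hc : IsCutoff q p c) (d e : ℕ) (hd : 0 < d) (he : 1 ≤ e) (hce : ∀ x, c x ≤ 2 * e) :
    ∀ (N : ℕ) (k : ℕ) (F : Finset (Fin n)) (A : Set (Fin n → Bool))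
      (L : List (MvPoly n × Finset (Fin ℓ))) (t : Fin m → MvPoly n), F.card = N →
      (∀ i ∈ F, ∀ a ∈ A, ∀ b, Function.update a i b ∈ A) →
      (∀ x ∈ L, x.2.card ≤ w) → (∀ x ∈ L, Good F x.1) → (∀ j, Good F (t j)) →
      (∀ a ∈ A, -1 = eval (ptv a) (expr q p L t)) →
      (tot L t (tc d) : ℝ) < Real.exp ((d : ℝ) / (2 * (n + 1)) * k) →
      Cone q p c w A (2 * (d - 1 + k + e)) (fun _ => -1) := by
  intro N
  induction N with
  | zero =>
    intro k F A L t hF hfree hw hL ht hid hT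
    have hF : F = ∅ := Finset.card_eq_zero.1 hF
    subst hF
    have hg : ∀ r : MvPoly n, Good ∅ r → r.totalDegree ≤ d - 1 := by
      intro r hr
      refine Finset.sup_le fun α hα => ?_
      have : α = 0 := by
        ext v
        by_contra hv
        simpa using (hr α hα v).2 hv
      simp [this]
    refine ⟨L, t, fun x hx => ⟨hw x hx, ?_⟩, fun j => ?_, hid⟩
    · have h1 := hg _ (hL x hx)
      have h2 : cut c x.2 ≤ 2 * e := by
        unfold cut; split_ifs; exacts [by omega, hce _]
      omega
    · have := hg _ (ht j)
      have := hce (Sum.inr j)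
      omega
  | succ N ih =>
    intro k F A L t hF hfree hw hL ht hid hT
    by_cases hT0 : tot L t (tc d) = 0
    · obtain ⟨z1, z2⟩ := tot_eq_zero hT0
      refine ⟨L, t, fun x hx => ⟨hw x hx, ?_⟩, fun j => ?_, hid⟩
      · have h1 := deg_of_tc hd (z1 x hx)
        have h2 : cut c x.2 ≤ 2 * e := by
          unfold cut; split_ifs; exacts [by omega, hce _]
        omega
      · have := deg_of_tc hd (z2 j)
        have := hce (Sum.inr j)
        omega
    have hT1 : (1 : ℝ) ≤ tot L t (tc d) := by exact_mod_cast Nat.one_le_iff_ne_zero.2 hT0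
    obtain ⟨T, hTdef⟩ : ∃ T : ℝ, T = ((tot L t (tc d) : ℕ) : ℝ) := ⟨_, rfl⟩
    rw [← hTdef] at hT hT1
    obtain ⟨θ, hθ⟩ : ∃ θ : ℝ, θ = (d : ℝ) / (2 * (n + 1)) := ⟨_, rfl⟩
    rw [← hθ] at hT ih
    have hd' : (0 : ℝ) < d := by exact_mod_cast hd
    have hθ0 : 0 < θ := by rw [hθ]; positivity
    obtain ⟨k, rfl⟩ : ∃ k', k = k' + 1 := by
      rcases k with _ | k
      · simp at hT; linarith
      · exact ⟨k, rfl⟩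
    have havg : (d : ℝ) * T ≤ ∑ y, (tot L t (tcy d y) : ℝ) := by
      have h1 : d * tot L t (tc d) ≤ ∑ y, tot L t (tcy d y) := by
        rw [← tot_mul, ← tot_sum]
        exact tot_mono _ _ _ _ (fun x hx => (hL x hx).avg d) (fun j => (ht j).avg d)
      rw [hTdef]
      exact_mod_cast h1
    obtain ⟨y, hy⟩ : ∃ y, θ * T ≤ (tot L t (tcy d y) : ℝ) := by
      by_contra hcon
      push Not at hcon
      have h1 : ∑ y : Fin n ⊕ Fin n, (tot L t (tcy d y) : ℝ) ≤ ∑ y : Fin n ⊕ Fin n, θ * T :=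
        Finset.sum_le_sum fun y _ => (hcon y).le
      simp only [Finset.sum_const, Finset.card_univ, Fintype.card_sum, Fintype.card_fin,
        nsmul_eq_mul] at h1
      have h2 : θ * (2 * (n + 1)) = d := by rw [hθ]; field_simp
      push_cast at h1
      have h3 : 0 < θ * T := by positivity
      nlinarith
    have hyF : var y ∈ F := by
      by_contra hyF
      have h0 : ∀ r, Good F r → tcy d y r = 0 := by
        intro r hr
        rw [tcy, Finset.card_eq_zero, Finset.filter_eq_empty_iff]
        intro α hα hne
        exact hyF ((hr α (Finset.mem_filter.1 hα).1 y).2 hne)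
      have h1 : tot L t (tcy d y) ≤ tot L t (fun _ => 0) :=
        tot_mono _ _ _ _ (fun x hx => (h0 _ (hL x hx)).le) (fun j => (h0 _ (ht j)).le)
      have h2 : tot L t (fun _ => 0) = 0 := by simp [tot]
      rw [h2] at h1
      have h3 : (tot L t (tcy d y) : ℝ) ≤ 0 := by exact_mod_cast h1
      have h4 : 0 < θ * T := by positivity
      linarith
    have hcard : (F.erase (var y)).card = N := by rw [Finset.card_erase_of_mem hyF, hF, Nat.add_sub_cancel]
    have step : ∀ (z : Fin n ⊕ Fin n) (k' : ℕ), var z = var y →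
        (tot (L.map fun x => (restr z x.1, x.2)) (fun j => restr z (t j)) (tc d) : ℝ)
          < Real.exp (θ * k') →
        Cone q p c w (A ∩ {a | ptv a z = 0}) (2 * (d - 1 + k' + e)) (fun _ => -1) := by
      intro z k' hz hlt
      refine ih k' (F.erase (var y)) (A ∩ {a | ptv a z = 0}) (L.map fun x => (restr z x.1, x.2)) (fun j => restr z (t j))
        hcard ?_ ?_ ?_ ?_ ?_ ?_
      rotate_right
      · exact hlt
      · intro i hi a ha b
        rw [Finset.mem_erase] at hi
        refine ⟨hfree i hi.2 a ha.1 b, ?_⟩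
        change ptv _ z = 0
        rw [ptv_update_ne _ _ _ _ (by rw [hz]; exact hi.1.symm)]
        exact ha.2
      · intro x hx
        obtain ⟨x', hx', rfl⟩ := List.mem_map.1 hx
        exact hw x' hx'
      · intro x hx
        obtain ⟨x', hx', rfl⟩ := List.mem_map.1 hx
        rw [← hz]
        exact (hL x' hx').restr z
      · intro j
        rw [← hz]
        exact (ht j).restr z
      · intro a ha
        rw [expr_restr z L t a ha.2]
        exact hid a ha.1
    have c0 := step y k rfl (by
      have h1 : (tot (L.map fun x => (restr y x.1, x.2)) (fun j => restr y (t j)) (tc d) : ℝ)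
          + tot L t (tcy d y) ≤ T := by
        rw [hTdef]; exact_mod_cast tot_restr y d L t
      have h2 : 1 - θ ≤ Real.exp (-θ) := Real.one_sub_le_exp_neg θ
      have h3 : T * (1 - θ) ≤ T * Real.exp (-θ) := by gcongr
      have h4 : T * Real.exp (-θ) < Real.exp (θ * (k + 1 : ℕ)) * Real.exp (-θ) := by
        gcongr
      rw [← Real.exp_add] at h4
      have h5 : θ * ((k + 1 : ℕ) : ℝ) + -θ = θ * k := by push_cast; ring
      rw [h5] at h4
      linarith)
    have c1 := step y.swap (k + 1) (var_swap y) (by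
      refine lt_of_le_of_lt ?_ hT
      rw [hTdef]
      have h1 := tot_restr y.swap d L t
      exact Nat.cast_le.2 ((Nat.le_add_right _ _).trans h1))
    have hz : Cone q p c w A (2 * (d - 1 + (k + 1) + e)) (fun a => -ptv a y.swap) := by
      have := c0.mulsq (A := A) (X y.swap) (by
        intro a ha
        rw [eval_X, ptv_swap]
        rcases ptv_01 a y with h | h
        · exact Or.inr ⟨ha, h⟩
        · left; rw [h]; ring)
      rw [totalDegree_X] at this
      have e1 : 2 * (d - 1 + (k + 1) + e) = 2 * (d - 1 + k + e) + 2 * 1 := by ring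
      rw [e1]
      refine this.congr fun a _ => ?_
      rw [eval_X, pow_01 (ptv_01 _ _) two_ne_zero]; ring
    refine combine hc (fun j => ?_) (by omega) y.swap ?_ hz c1
    · have := hce (Sum.inr j); omega
    · rw [var_swap]; exact hfree _ hyF

lemma eval_boolAxiom (a : Fin n → Bool) (x : Fin 3 × Fin n) :
    eval (ptv a) (boolAxiom n x) = 0 := by
  unfold boolAxiom
  split_ifs <;> simp [ptv] <;> split_ifs <;> norm_num

/-- Flattening of a proof. -/
def flat {goal : MvPoly n} (π : PSProof n ℓ m q p goal) : List (MvPoly n × Finset (Fin ℓ)) :=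
  π.r0.map (fun r => (r, ∅)) ++ π.Js.toList.flatMap (fun J => (π.r J).map fun r => (r, J))

lemma sum_flat {M : Type*} [AddCommMonoid M] {goal : MvPoly n} (π : PSProof n ℓ m q p goal)
    (φ : MvPoly n × Finset (Fin ℓ) → M) :
    ((flat π).map φ).sum = (π.r0.map fun r => φ (r, ∅)).sum
      + ∑ J ∈ π.Js, ((π.r J).map fun r => φ (r, J)).sum := by
  simp only [flat, List.map_append, List.sum_append, List.map_map, Function.comp_def,
    List.map_flatMap]
  congr 1
  rw [← Finset.sum_map_toList]
  generalize π.Js.toList = l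
  induction l with
  | nil => simp
  | cons J l ih => simp [ih]

lemma mem_flat {goal : MvPoly n} (π : PSProof n ℓ m q p goal) {x} (hx : x ∈ flat π) :
    (x.2 = ∅ ∧ x.1 ∈ π.r0) ∨ (x.2 ∈ π.Js ∧ x.1 ∈ π.r x.2) := by
  simp only [flat, List.mem_append, List.mem_map, List.mem_flatMap, Finset.mem_toList] at hx
  rcases hx with ⟨r, hr, rfl⟩ | ⟨J, hJ, r, hr, rfl⟩
  · exact Or.inl ⟨rfl, hr⟩
  · exact Or.inr ⟨hJ, hr⟩

lemma flat_expr {goal : MvPoly n} (π : PSProof n ℓ m q p goal) (a : Fin n → Bool) :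
    eval (ptv a) goal = eval (ptv a) (expr q p (flat π) π.t) := by
  have h := congrArg (eval (ptv a)) π.identity
  rw [h, map_add, map_sum]
  simp only [map_mul, eval_boolAxiom, mul_zero, Finset.sum_const_zero, add_zero]
  congr 2
  rw [sum_flat]
  simp [sosOf, List.sum_map_mul_right]

lemma sosOf_deg (l : List (MvPoly n)) (k : ℕ) (h : ∀ r ∈ l, 2 * r.totalDegree ≤ k) :
    (sosOf l).totalDegree ≤ k := by
  unfold sosOf
  induction l with
  | nil => simp
  | cons r l ih =>
    rw [List.map_cons, List.sum_cons]
    refine (totalDegree_add _ _).trans (max_le ?_ (ih fun s hs => h s (by simp [hs])))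
    exact (totalDegree_pow _ _).trans (h r (by simp))

open Classical in
/-- The polynomials of the list with index `J`. -/
def part (L : List (MvPoly n × Finset (Fin ℓ))) (J : Finset (Fin ℓ)) : List (MvPoly n) :=
  (L.filter fun x => x.2 = J).map Prod.fst

lemma mem_part {L : List (MvPoly n × Finset (Fin ℓ))} {J r} (h : r ∈ part L J) : (r, J) ∈ L := by
  simpa [part] using h

lemma sum_part (L : List (MvPoly n × Finset (Fin ℓ))) (S : Finset (Finset (Fin ℓ)))
    (h : ∀ x ∈ L, x.2 ∈ S) :
    (L.map fun x => x.1 ^ 2 * ∏ j ∈ x.2, q j).sum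
      = ∑ J ∈ S, sosOf (part L J) * ∏ j ∈ J, q j := by
  classical
  induction L with
  | nil => simp [part, sosOf]
  | cons x L ih =>
    rw [List.map_cons, List.sum_cons, ih fun y hy => h y (by simp [hy])]
    have : ∀ J, sosOf (part (x :: L) J) * ∏ j ∈ J, q j
        = (if x.2 = J then x.1 ^ 2 * ∏ j ∈ J, q j else 0) + sosOf (part L J) * ∏ j ∈ J, q j := by
      intro J
      by_cases hJ : x.2 = J
      · simp [part, sosOf, List.filter_cons, hJ, add_mul]
      · simp [part, sosOf, List.filter_cons, hJ]
    simp only [this, Finset.sum_add_distrib, Finset.sum_ite_eq, h x (by simp), if_true]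

lemma toProof (hcD : ∀ x, c x ≤ D) (H : Cone q p c w Set.univ D (fun _ => -1)) :
    ∃ π : PSProof n ℓ m q p (-1), π.widthLE w ∧ π.degreeModLE c D := by
  classical
  obtain ⟨L, t, h1, h2, h3⟩ := H
  obtain ⟨u, hu⟩ := cube_null (-1 - expr q p L t) (by
    intro a
    rw [map_sub, ← h3 a trivial, map_neg, map_one, sub_self])
  set S : Finset (Finset (Fin ℓ)) := Finset.univ.filter fun J => J.card ≤ w with hS
  have hS0 : ∅ ∈ S := by simp [hS]
  refine ⟨⟨S.erase ∅, by simp, part L ∅, part L, t, u, ?_⟩, ?_, ?_, ?_, ?_, ?_⟩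
  · rw [← hu, expr, sum_part L S (fun x hx => by simp [hS, (h1 x hx).1]),
      ← Finset.add_sum_erase S _ hS0, Finset.prod_empty]
    ring
  · intro J hJ
    exact (Finset.mem_filter.1 (Finset.mem_of_mem_erase hJ)).2
  · simp
  · refine sosOf_deg _ _ fun r hr => ?_
    have := (h1 _ (mem_part hr)).2
    dsimp only at this
    omega
  · intro J hJ _
    have hJ0 : J ≠ ∅ := Finset.ne_of_mem_erase hJ
    have := sosOf_deg (part L J) (D - c (Sum.inl J)) fun r hr => by
      have := (h1 _ (mem_part hr)).2
      simp only [cut, hJ0, if_false] at this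
      omega
    have := hcD (Sum.inl J)
    dsimp only
    omega
  · exact fun j _ => h2 j

end
end PSDR

/-- **Lemma 9 (degree reduction).** If `Q` has a multilinear PS refutation of
product-width at most `w` with at most `s` explicit monomials of degree at least `d`,
then `Q` has a PS refutation of product-width at most `w` and degree mod `c` at most
`2d' + 2d''` with `d' = d + ⌊2(n+1)·log s / d⌋` and `d'' = max{1, ⌈(max c)/2⌉}`. -/
theorem statement9 (n ℓ m : ℕ) (q : Fin ℓ → MvPoly n) (p : Fin m → MvPoly n)
    (c : Finset (Fin ℓ) ⊕ Fin m → ℕ) (hc : IsCutoff q p c)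
    (s : ℝ) (hs : 1 ≤ s) (w d : ℕ) (hw : 0 < w) (hd : 0 < d)
    (h : ∃ π : PSProof n ℓ m q p (-1),
      π.Multilinear ∧ π.widthLE w ∧ (π.tallMonCount d : ℝ) ≤ s) :
    ∃ π : PSProof n ℓ m q p (-1), π.widthLE w ∧
      π.degreeModLE c
        (2 * (d + ⌊2 * (n + 1 : ℝ) * Real.log s / d⌋₊)
          + 2 * max 1 ((Finset.univ.sup c + 1) / 2)) := by
  obtain ⟨π, hml, hwd, hT⟩ := h
  set e := max 1 ((Finset.univ.sup c + 1) / 2) with he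
  set k := ⌊2 * (n + 1 : ℝ) * Real.log s / d⌋₊ with hk
  have he1 : 1 ≤ e := le_max_left _ _
  have hce : ∀ x, c x ≤ 2 * e := by
    intro x
    have h1 : c x ≤ Finset.univ.sup c := Finset.le_sup (Finset.mem_univ x)
    have h2 : (Finset.univ.sup c + 1) / 2 ≤ e := le_max_right _ _
    omega
  have hd' : (0 : ℝ) < d := by exact_mod_cast hd
  have hn : (0 : ℝ) < n + 1 := by positivity
  have hs0 : (0 : ℝ) < s := by linarith
  have good : ∀ r : MvPoly n, IsMultilinearPoly r → PSDR.Good Finset.univ r :=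
    fun r hr α hα v => ⟨hr α hα v, fun _ => Finset.mem_univ _⟩
  have htot : PSDR.tot (PSDR.flat π) π.t (PSDR.tc d) = π.tallMonCount d := by
    rw [PSDR.tot, PSDR.sum_flat]; rfl
  have key := PSDR.main (w := w) hc d e hd he1 hce n (k + 1) Finset.univ Set.univ
    (PSDR.flat π) π.t (by simp) (fun _ _ _ _ _ => trivial) (by
      intro x hx
      rcases PSDR.mem_flat π hx with h | h
      · simp [h.1]
      · exact hwd _ h.1) (by
      intro x hx
      rcases PSDR.mem_flat π hx with h | h
      · exact good _ (hml.1 _ h.2)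
      · exact good _ (hml.2.1 _ h.1 _ h.2))
    (fun j => good _ (hml.2.2 j))
    (fun a _ => by rw [← PSDR.flat_expr π a]; simp) (by
      rw [htot]
      refine lt_of_le_of_lt hT ?_
      rw [← Real.log_lt_iff_lt_exp hs0]
      have h1 := Nat.lt_floor_add_one (2 * (n + 1 : ℝ) * Real.log s / d)
      rw [← hk, div_lt_iff₀ hd'] at h1
      rw [div_mul_eq_mul_div, lt_div_iff₀ (by positivity)]
      push_cast
      linarith)
  have e1 : 2 * (d - 1 + (k + 1) + e) = 2 * (d + k) + 2 * e := by omega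
  rw [e1] at key
  exact PSDR.toProof (fun x => by have := hce x; omega) key
end
end

section
/- Let 𝒥 be a MAX-CSP instance with n Boolean variables x₁,…,xₙ and m constraints of arity at most k, represented by multilinear polynomials p₁,…,pₘ (each p_j multilinear of degree at most k in the variables of its constraint). Let Q = {p_j(x) = 1 : j ∈ [m]} and let Q' = {p_j(x) = y_j : j ∈ [m]} ∪ {(1/m)·Σ_{j=1}^m y_j ≥ 1}, where y₁,…,yₘ are fresh pairs of twin Boolean variables. If there is a degree-2dk SOS pseudo-expectation E for Q, then there is a degree-2d SOS pseudo-expectation E' for Q'. -/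
open MvPolynomial

noncomputable section

/-- The polynomial ring with a pair of twin variables for each element of `τ`:
`Sum.inl v` is the basic variable and `Sum.inr v` is its twin. -/
abbrev TwinPoly (τ : Type) : Type := MvPolynomial (τ ⊕ τ) ℝ

/-- The Boolean axioms `x² − x`, `x̄² − x̄` and `x + x̄ − 1` for each pair of twin
variables. -/
def boolAxT (τ : Type) (a : Fin 3 × τ) : TwinPoly τ :=
  if a.1 = 0 then X (Sum.inl a.2) ^ 2 - X (Sum.inl a.2)
  else if a.1 = 1 then X (Sum.inr a.2) ^ 2 - X (Sum.inr a.2)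
  else X (Sum.inl a.2) + X (Sum.inr a.2) - 1

/-- The sum of squares of a list of polynomials. -/
def sosOfT {τ : Type} (l : List (TwinPoly τ)) : TwinPoly τ := (l.map (· ^ 2)).sum

/-- An SOS proof of `goal ≥ 0` from the inequality constraints `q j ≥ 0` and the
equality constraints `p j = 0`. -/
structure SOSProof (τ : Type) [Fintype τ] (ℓ m : ℕ) (q : Fin ℓ → TwinPoly τ)
    (p : Fin m → TwinPoly τ) (goal : TwinPoly τ) : Type where
  r0 : List (TwinPoly τ)
  r : Fin ℓ → List (TwinPoly τ)
  t : Fin m → TwinPoly τ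
  u : Fin 3 × τ → TwinPoly τ
  identity : goal = sosOfT r0 + ∑ j, sosOfT (r j) * q j
      + ∑ j, t j * p j + ∑ a, u a * boolAxT τ a

/-- The SOS proof has degree at most `D` (the zero polynomial having degree `−∞`). -/
def SOSProof.degreeLE {τ : Type} [Fintype τ] {ℓ m : ℕ} {q : Fin ℓ → TwinPoly τ}
    {p : Fin m → TwinPoly τ} {goal : TwinPoly τ}
    (π : SOSProof τ ℓ m q p goal) (D : ℕ) : Prop :=
  goal.totalDegree ≤ D ∧ (sosOfT π.r0).totalDegree ≤ D ∧
  (∀ j, sosOfT (π.r j) ≠ 0 → (sosOfT (π.r j)).totalDegree + (q j).totalDegree ≤ D) ∧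
  (∀ j, π.t j ≠ 0 → (π.t j).totalDegree + (p j).totalDegree ≤ D)

/-- Polynomials of degree at most `D` having an SOS proof of degree at most `D`. -/
def SOScone (τ : Type) [Fintype τ] (ℓ m : ℕ) (q : Fin ℓ → TwinPoly τ)
    (p : Fin m → TwinPoly τ) (D : ℕ) : Set (TwinPoly τ) :=
  {g | g.totalDegree ≤ D ∧ ∃ π : SOSProof τ ℓ m q p g, π.degreeLE D}

/-- Degree-`D` SOS pseudo-expectations: linear functionals on the space of
polynomials of degree at most `D` sending `1` to `1` and the SOS-provable
nonnegative polynomials to nonnegatives. -/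
def SOSPseudoExp (τ : Type) [Fintype τ] (ℓ m : ℕ) (q : Fin ℓ → TwinPoly τ)
    (p : Fin m → TwinPoly τ) (D : ℕ) :
    Set ((restrictTotalDegree (τ ⊕ τ) ℝ D) →ₗ[ℝ] ℝ) :=
  {E | (∀ g : restrictTotalDegree (τ ⊕ τ) ℝ D, (g : TwinPoly τ) = 1 → E g = 1) ∧
    (∀ g : restrictTotalDegree (τ ⊕ τ) ℝ D,
      (g : TwinPoly τ) ∈ SOScone τ ℓ m q p D → 0 ≤ E g)}

/-- A polynomial is multilinear if no variable occurs with exponent `≥ 2`. -/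
def IsMultilinearT {σ : Type} (r : MvPolynomial σ ℝ) : Prop :=
  ∀ α ∈ r.support, ∀ v, α v ≤ 1

/-- Substitution by polynomials of degree at most one does not raise the degree. -/
theorem totalDegree_aeval_le_of_le_one {σ ρ : Type} (f : σ → MvPolynomial ρ ℝ)
    (hf : ∀ i, (f i).totalDegree ≤ 1) (g : MvPolynomial σ ℝ) :
    (aeval f g).totalDegree ≤ g.totalDegree := by
  rw [aeval_def, eval₂_eq]
  refine totalDegree_finsetSum_le (fun α hα => ?_)
  refine (totalDegree_mul _ _).trans ?_
  have h1 : (algebraMap ℝ (MvPolynomial ρ ℝ) (coeff α g)).totalDegree = 0 := by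
    rw [algebraMap_eq]; exact totalDegree_C _
  rw [h1, zero_add]
  refine (totalDegree_finset_prod _ _).trans ?_
  refine le_trans ?_ (le_totalDegree hα)
  refine Finset.sum_le_sum (fun i _ => ?_)
  refine (totalDegree_pow _ _).trans ?_
  calc α i * (f i).totalDegree ≤ α i * 1 := Nat.mul_le_mul_left _ (hf i)
    _ = α i := mul_one _

/-- The substitution `y ↦ 1`, `ȳ ↦ 0`. -/
def substY (n m : ℕ) : (Fin n ⊕ Fin m) ⊕ (Fin n ⊕ Fin m) → TwinPoly (Fin n)
  | Sum.inl (Sum.inl i) => X (Sum.inl i)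
  | Sum.inl (Sum.inr _) => 1
  | Sum.inr (Sum.inl i) => X (Sum.inr i)
  | Sum.inr (Sum.inr _) => 0

theorem substY_deg (n m : ℕ) (i) : (substY n m i).totalDegree ≤ 1 := by
  rcases i with (i | i) | (i | i) <;> simp [substY]

theorem substY_rename (n m : ℕ) (p : TwinPoly (Fin n)) :
    aeval (substY n m) (rename (Sum.map Sum.inl Sum.inl) p) = p := by
  rw [aeval_rename]
  have : substY n m ∘ (Sum.map Sum.inl Sum.inl) = X := by
    funext i
    rcases i with i | i <;> simp [substY]
  rw [this, aeval_X_left_apply]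

theorem map_sosOfT {τ τ' : Type} (f : TwinPoly τ →ₐ[ℝ] TwinPoly τ') (l : List (TwinPoly τ)) :
    f (sosOfT l) = sosOfT (l.map f) := by
  induction l with
  | nil => simp [sosOfT]
  | cons a l ih => simp [sosOfT] at ih ⊢; rw [ih]

theorem eval_sosOfT {τ : Type} (x : τ ⊕ τ → ℝ) (l : List (TwinPoly τ)) :
    0 ≤ eval x (sosOfT l) := by
  induction l with
  | nil => simp [sosOfT]
  | cons a l ih => simp [sosOfT] at ih ⊢; positivity

theorem substY_avg (n m : ℕ) (hm : 0 < m) :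
    aeval (substY n m) (C (1 / (m : ℝ)) * (∑ j : Fin m, X (Sum.inl (Sum.inr j))) - 1) = 0 := by
  have hm' : (m : ℝ) ≠ 0 := by positivity
  have : ((m : ℕ) : TwinPoly (Fin n)) = C (m : ℝ) := by simp
  simp only [map_sub, map_mul, map_sum, aeval_X, substY, map_one, Finset.sum_const,
    Finset.card_univ, Fintype.card_fin, nsmul_eq_mul, mul_one, this, algHom_C, algebraMap_eq]
  rw [← C_mul, one_div_mul_cancel hm', C_1, sub_self]

theorem substY_bool (n m : ℕ) (u : Fin 3 × (Fin n ⊕ Fin m) → TwinPoly (Fin n ⊕ Fin m)) :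
    aeval (substY n m) (∑ a, u a * boolAxT (Fin n ⊕ Fin m) a)
      = ∑ a : Fin 3 × Fin n, aeval (substY n m) (u (a.1, Sum.inl a.2)) * boolAxT (Fin n) a := by
  simp [Fintype.sum_prod_type, Fin.sum_univ_three, boolAxT, substY]

/-- **Lemma (pseudo-expectations for MAX-CSP reformulations).** Let `𝒥` be a
MAX-CSP instance with `n` Boolean variables and `m` constraints of arity at most
`k`, represented by multilinear polynomials `pj j` of degree at most `k` in the
basic variables.  Let `Q = {pj j = 1}` and let `Q'` be the system
`{pj j = y_j} ∪ {(1/m)·Σ y_j ≥ 1}` on the `n + m` pairs of twin variables.  If `Q`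
has a degree-`2dk` SOS pseudo-expectation, then `Q'` has a degree-`2d` one. -/
theorem statement17 (n m k d : ℕ) (hm : 0 < m)
    (pj : Fin m → TwinPoly (Fin n))
    (hmult : ∀ j, IsMultilinearT (pj j))
    (hdeg : ∀ j, (pj j).totalDegree ≤ k)
    (hbasic : ∀ j, ∀ α ∈ (pj j).support, ∀ i : Fin n, α (Sum.inr i) = 0)
    (hE : (SOSPseudoExp (Fin n) 0 m (fun j : Fin 0 => j.elim0)
      (fun j => pj j - 1) (2 * d * k)).Nonempty) :
    (SOSPseudoExp (Fin n ⊕ Fin m) 1 m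
      (fun _ : Fin 1 => C (1 / (m : ℝ))
          * (∑ j : Fin m, X (Sum.inl (Sum.inr j))) - 1)
      (fun j => rename (Sum.map Sum.inl Sum.inl) (pj j) - X (Sum.inl (Sum.inr j)))
      (2 * d)).Nonempty := by
  obtain ⟨E, hE1, hE2⟩ := hE
  rcases Nat.eq_zero_or_pos k with rfl | hk
  · -- constant constraints: evaluate at `x = 0`, `x̄ = 1`, `y = 1`, `ȳ = 0`
    have hone : ∀ j, pj j = 1 := by
      intro j
      obtain ⟨c, hc⟩ : ∃ c, pj j = C c :=
        ⟨_, totalDegree_eq_zero_iff_eq_C.mp (Nat.le_zero.mp (hdeg j))⟩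
      by_contra hne
      have hc1 : c - 1 ≠ 0 := by
        intro h
        apply hne
        rw [hc, sub_eq_zero.mp h, C_1]
      have hmem : (-1 : TwinPoly (Fin n)) ∈ restrictTotalDegree (Fin n ⊕ Fin n) ℝ (2 * d * 0) := by
        rw [mem_restrictTotalDegree]; simp
      have h1mem : (1 : TwinPoly (Fin n)) ∈ restrictTotalDegree (Fin n ⊕ Fin n) ℝ (2 * d * 0) := by
        rw [mem_restrictTotalDegree]; simp
      have h1 := hE1 ⟨1, h1mem⟩ rfl
      have h2 : E ⟨-1, hmem⟩ = -1 := by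
        rw [← h1, ← map_neg]; rfl
      have h3 : 0 ≤ E ⟨-1, hmem⟩ := by
        refine hE2 _ ⟨by simp, ⟨⟨[], fun i => i.elim0,
          fun i => if i = j then C (-(c - 1)⁻¹) else 0, fun _ => 0, ?_⟩, ?_⟩⟩
        · simp only [sosOfT, List.map_nil, List.sum_nil, Finset.univ_eq_empty, Finset.sum_empty,
            ite_mul, zero_mul, Finset.sum_ite_eq', Finset.mem_univ, if_true, Finset.sum_const_zero,
            zero_add, add_zero, hc]
          rw [← C_1, ← C_sub, ← C_mul, ← C_neg, neg_mul, inv_mul_cancel₀ hc1]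
        · refine ⟨by simp, by simp [sosOfT], fun i => i.elim0, ?_⟩
          intro i hi
          dsimp only at hi ⊢
          by_cases hij : i = j
          · subst hij
            rw [if_pos rfl, totalDegree_C, hc, ← C_1, ← C_sub, totalDegree_C]; simp
          · rw [if_neg hij] at hi; exact absurd rfl hi
      linarith
    let x : Fin n ⊕ Fin n → ℝ := Sum.elim (fun _ => 0) (fun _ => 1)
    refine ⟨((aeval x).comp (aeval (substY n m))).toLinearMap ∘ₗ
      (restrictTotalDegree _ ℝ (2 * d)).subtype, ?_, ?_⟩
    · intro g hg
      simp [hg]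
    · intro g hg
      obtain ⟨-, π, -⟩ := hg
      have hid := congrArg (aeval (substY n m)) π.identity
      rw [map_add, map_add, map_add, substY_bool, map_sosOfT] at hid
      simp only [map_sum, map_mul, substY_avg n m hm, map_sub, substY_rename, aeval_X, hone] at hid
      have := eval_sosOfT x (π.r0.map (aeval (substY n m)))
      simp only [LinearMap.comp_apply, Submodule.subtype_apply, AlgHom.toLinearMap_apply,
        AlgHom.comp_apply]
      rw [hid]
      simpa [substY, Fintype.sum_prod_type, Fin.sum_univ_three, boolAxT, x, aeval_eq_eval] using this
  · have hD : 2 * d ≤ 2 * d * k := Nat.le_mul_of_pos_right _ hk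
    have hdeg' := totalDegree_aeval_le_of_le_one (substY n m) (substY_deg n m)
    let L : restrictTotalDegree ((Fin n ⊕ Fin m) ⊕ (Fin n ⊕ Fin m)) ℝ (2 * d) →ₗ[ℝ]
        restrictTotalDegree (Fin n ⊕ Fin n) ℝ (2 * d * k) :=
      LinearMap.restrict (aeval (substY n m)).toLinearMap (fun g hg => by
        rw [mem_restrictTotalDegree] at hg ⊢
        exact (hdeg' g).trans (hg.trans hD))
    have hL : ∀ g, (L g : TwinPoly (Fin n)) = aeval (substY n m) (g : TwinPoly (Fin n ⊕ Fin m)) :=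
      fun g => rfl
    refine ⟨E ∘ₗ L, ?_, ?_⟩
    · intro g hg
      apply hE1
      rw [hL, hg, map_one]
    · intro g hg
      obtain ⟨hgd, π, -, hπ0, -, hπt⟩ := hg
      apply hE2
      have hgd' : (L g : TwinPoly (Fin n)).totalDegree ≤ 2 * d * k :=
        (mem_restrictTotalDegree _ _ _).mp (L g).2
      have hid := congrArg (aeval (substY n m)) π.identity
      rw [map_add, map_add, map_add, substY_bool, map_sosOfT] at hid
      simp only [map_sum, map_mul, substY_avg n m hm, map_sub, substY_rename, aeval_X] at hid
      refine ⟨hgd', ⟨⟨π.r0.map (aeval (substY n m)), fun i => i.elim0,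
        fun j => aeval (substY n m) (π.t j),
        fun a => aeval (substY n m) (π.u (a.1, Sum.inl a.2)), ?_⟩, ?_⟩⟩
      · rw [hL, hid]
        simp [substY, substY_avg n m hm]
      · refine ⟨hgd', ?_, fun i => i.elim0, ?_⟩
        · dsimp only
          rw [← map_sosOfT]
          exact (hdeg' _).trans (hπ0.trans hD)
        · intro j hj
          dsimp only at hj ⊢
          have hne : π.t j ≠ 0 := fun h => hj (by rw [h, map_zero])
          refine le_trans (add_le_add (hdeg' _) ?_) ((hπt j hne).trans hD)
          have := hdeg' (rename (Sum.map Sum.inl Sum.inl) (pj j) - X (Sum.inl (Sum.inr j)))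
          rwa [map_sub, substY_rename, aeval_X] at this
end
end

section
/- There exists ε ∈ ℝ, ε > 0, such that for every sufficiently large n ∈ ℕ and every k ∈ [n], every SOS refutation of the Knapsack system KS_{n,k}, given by the single polynomial equation 2x₁ + ⋯ + 2xₙ − k = 0 on n pairs of twin Boolean variables, has monomial size at least 2^{ε·k²/n}. -/
open MvPolynomial

noncomputable section

/-- The Knapsack polynomial `2x₁ + ⋯ + 2xₙ − k`, the single equality constraint of
the system `KS_{n,k}`. -/
def knapsackPoly (n k : ℕ) : MvPoly n :=
  C 2 * (∑ i : Fin n, X (Sum.inl i)) - C (k : ℝ)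


namespace KS

open Finset

/-- Falling-factorial pseudo-probabilities. -/
def Phi (κ μ : ℝ) (a b : ℕ) : ℝ :=
  (∏ i ∈ range a, (κ - i)) * (∏ i ∈ range b, (μ - i)) / ∏ i ∈ range (a + b), (κ + μ - i)

lemma Phi_pascal (κ μ : ℝ) (m : ℕ) (hm : κ + μ = m) (a b : ℕ) (h : a + b < m) :
    Phi κ μ (a + 1) b + Phi κ μ a (b + 1) = Phi κ μ a b := by
  unfold Phi
  have h1 : ∏ i ∈ range (a + b), (κ + μ - i) ≠ 0 := by
    rw [Finset.prod_ne_zero_iff]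
    intro i hi
    rw [hm]
    have : i < m := by have := Finset.mem_range.1 hi; omega
    have : (i : ℝ) < m := by exact_mod_cast this
    linarith
  have h2 : (κ + μ - ((a + b : ℕ) : ℝ)) ≠ 0 := by
    rw [hm]
    have : ((a + b : ℕ) : ℝ) < m := by exact_mod_cast h
    linarith
  rw [show a + 1 + b = (a + b) + 1 by ring, show a + (b + 1) = (a + b) + 1 by ring]
  simp only [Finset.prod_range_succ]
  field_simp
  push_cast
  ring

lemma Phi_nonneg (κ μ : ℝ) (m : ℕ) (hm : κ + μ = m) (a b : ℕ) (h : a + b ≤ m)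
    (ha : (a : ℝ) ≤ κ) (hb : (b : ℝ) ≤ μ) : 0 ≤ Phi κ μ a b := by
  unfold Phi
  apply div_nonneg
  · apply mul_nonneg
    · apply Finset.prod_nonneg
      intro i hi
      have : (i : ℝ) < a := by exact_mod_cast Finset.mem_range.1 hi
      linarith
    · apply Finset.prod_nonneg
      intro i hi
      have : (i : ℝ) < b := by exact_mod_cast Finset.mem_range.1 hi
      linarith
  · apply Finset.prod_nonneg
    intro i hi
    have : i < m := by have := Finset.mem_range.1 hi; omega
    have : (i : ℝ) < m := by exact_mod_cast this
    linarith

lemma Phi_sum {α : Type*} [DecidableEq α] (κ μ : ℝ) (m : ℕ) (hm : κ + μ = m) (I : Finset α) :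
    ∀ a b : ℕ, a + b + I.card ≤ m →
      ∑ J ∈ I.powerset, Phi κ μ (a + I.card - J.card) (b + J.card) = Phi κ μ a b := by
  induction I using Finset.induction_on with
  | empty => intro a b _; simp
  | insert x I hx ih =>
    intro a b h
    rw [Finset.card_insert_of_notMem hx] at h
    rw [Finset.sum_powerset_insert hx, Finset.card_insert_of_notMem hx,
      ← Phi_pascal κ μ m hm a b (by omega), ← ih (a + 1) b (by omega), ← ih a (b + 1) (by omega)]
    congr 1
    · apply Finset.sum_congr rfl
      intro J hJ
      congr 1
      omega
    · apply Finset.sum_congr rfl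
      intro J hJ
      have hxJ : x ∉ J := fun h' => hx (Finset.mem_powerset.1 hJ h')
      rw [Finset.card_insert_of_notMem hxJ]
      congr 1 <;> omega

/-- The function `∏_{i ∈ S} x_i`, where `J` is the set of zeros. -/
def xS {n : ℕ} (S : Finset (Fin n)) : Finset (Fin n) → ℝ := fun J => if Disjoint S J then 1 else 0

lemma xS_mul {n : ℕ} (S T : Finset (Fin n)) : xS S * xS T = xS (S ∪ T) := by
  funext J
  simp only [xS, Pi.mul_apply, Finset.disjoint_union_left]
  by_cases h1 : Disjoint S J <;> by_cases h2 : Disjoint T J <;> simp [h1, h2]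

/-- The pseudo-expectation. -/
def E {n : ℕ} (κ μ : ℝ) (R : Finset (Fin n)) : (Finset (Fin n) → ℝ) →ₗ[ℝ] ℝ where
  toFun F := ∑ J ∈ R.powerset, Phi κ μ (R.card - J.card) J.card * F J
  map_add' F G := by simp [mul_add, Finset.sum_add_distrib]
  map_smul' c F := by
    simp only [Pi.smul_apply, smul_eq_mul, RingHom.id_apply, Finset.mul_sum]
    exact Finset.sum_congr rfl fun J _ => by ring

lemma E_xS {n : ℕ} (κ μ : ℝ) (R : Finset (Fin n)) (hm : κ + μ = R.card) (S : Finset (Fin n))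
    (hS : S ⊆ R) : E κ μ R (xS S) = Phi κ μ S.card 0 := by
  have hc := Finset.card_sdiff_add_card_eq_card hS
  rw [← Phi_sum κ μ R.card hm (R \ S) S.card 0 (by omega)]
  change ∑ J ∈ R.powerset, Phi κ μ (R.card - J.card) J.card * xS S J = _
  simp only [xS, mul_ite, mul_one, mul_zero]
  rw [← Finset.sum_filter]
  have : R.powerset.filter (fun J => Disjoint S J) = (R \ S).powerset := by
    ext J
    simp only [Finset.mem_filter, Finset.mem_powerset, Finset.subset_sdiff]
    exact and_congr_right fun _ => disjoint_comm
  rw [this]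
  apply Finset.sum_congr rfl
  intro J hJ
  congr 1 <;> omega

/-- Functions of degree at most `D` in the variables of `R`. -/
def V {n : ℕ} (R : Finset (Fin n)) (D : ℕ) : Submodule ℝ (Finset (Fin n) → ℝ) :=
  Submodule.span ℝ {f | ∃ S ⊆ R, S.card ≤ D ∧ f = xS S}

lemma xS_mem {n : ℕ} {R S : Finset (Fin n)} {D : ℕ} (h : S ⊆ R) (hD : S.card ≤ D) :
    xS S ∈ V R D := Submodule.subset_span ⟨S, h, hD, rfl⟩

lemma V_mono {n : ℕ} {R : Finset (Fin n)} {D D' : ℕ} (h : D ≤ D') : V R D ≤ V R D' := by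
  apply Submodule.span_mono
  rintro f ⟨S, hS, hc, rfl⟩
  exact ⟨S, hS, hc.trans h, rfl⟩

lemma V_mul {n : ℕ} {R : Finset (Fin n)} {D D' : ℕ} {f g : Finset (Fin n) → ℝ}
    (hf : f ∈ V R D) (hg : g ∈ V R D') : f * g ∈ V R (D + D') := by
  unfold V at hf hg
  induction hf using Submodule.span_induction with
  | mem f hf =>
    obtain ⟨S, hS, hc, rfl⟩ := hf
    induction hg using Submodule.span_induction with
    | mem g hg =>
      obtain ⟨T, hT, hc', rfl⟩ := hg
      rw [xS_mul]
      exact xS_mem (Finset.union_subset hS hT) ((Finset.card_union_le _ _).trans (by omega))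
    | zero => simp
    | add x y _ _ hx hy => rw [mul_add]; exact Submodule.add_mem _ hx hy
    | smul c x _ hx => rw [mul_smul_comm]; exact Submodule.smul_mem _ _ hx
  | zero => simp
  | add x y _ _ hx hy => rw [add_mul]; exact Submodule.add_mem _ hx hy
  | smul c x _ hx => rw [smul_mul_assoc]; exact Submodule.smul_mem _ _ hx

/-- The function `∑_{i ∈ R} x_i`. -/
def sumX {n : ℕ} (R : Finset (Fin n)) : Finset (Fin n) → ℝ := ∑ i ∈ R, xS {i}

lemma sumX_mul {n : ℕ} {R S : Finset (Fin n)} (hS : S ⊆ R) :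
    sumX R * xS S = (S.card : ℝ) • xS S + ∑ i ∈ R \ S, xS (insert i S) := by
  unfold sumX
  rw [Finset.sum_mul, ← Finset.sum_sdiff hS, add_comm]
  congr 1
  · rw [Finset.sum_congr rfl (g := fun _ => xS S)]
    · rw [Finset.sum_const, ← Nat.cast_smul_eq_nsmul ℝ]
    · intro i hi
      rw [xS_mul]
      congr 1
      rw [Finset.singleton_union, Finset.insert_eq_self.2 hi]
  · apply Finset.sum_congr rfl
    intro i hi
    rw [xS_mul, Finset.singleton_union]

lemma E_constraint {n : ℕ} (κ μ : ℝ) (R : Finset (Fin n)) (hm : κ + μ = R.card) (D : ℕ)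
    (hD : D < R.card) (f : Finset (Fin n) → ℝ) (hf : f ∈ V R D) :
    E κ μ R (sumX R * f) = κ * E κ μ R f := by
  unfold V at hf
  induction hf using Submodule.span_induction with
  | mem f hf =>
    obtain ⟨S, hS, hc, rfl⟩ := hf
    rw [sumX_mul hS, map_add, map_smul, map_sum, E_xS κ μ R hm S hS]
    rw [Finset.sum_congr rfl (g := fun _ => Phi κ μ (S.card + 1) 0)]
    · have hcc := Finset.card_sdiff_add_card_eq_card hS
      have hcr : ((R \ S).card : ℝ) = κ + μ - S.card := by
        rw [hm, ← hcc]; push_cast; ring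
      rw [Finset.sum_const, nsmul_eq_mul, smul_eq_mul, hcr]
      have hne : κ + μ - (S.card : ℝ) ≠ 0 := by
        rw [← hcr]
        have : 0 < (R \ S).card := by omega
        positivity
      unfold Phi
      simp only [Finset.prod_range_succ, add_zero, Finset.prod_range_zero, mul_one]
      have h1 : ∏ i ∈ range S.card, (κ + μ - i) ≠ 0 := by
        rw [Finset.prod_ne_zero_iff]
        intro i hi
        rw [hm]
        have : i < R.card := by have := Finset.mem_range.1 hi; omega
        have : (i : ℝ) < R.card := by exact_mod_cast this
        linarith
      field_simp
      ring
    · intro i hi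
      rw [Finset.mem_sdiff] at hi
      rw [E_xS κ μ R hm _ (Finset.insert_subset hi.1 hS), Finset.card_insert_of_notMem hi.2]
  | zero => simp
  | add x y _ _ hx hy => rw [mul_add, map_add, map_add, hx, hy]; ring
  | smul c x _ hx => rw [mul_smul_comm, map_smul, map_smul, hx, smul_eq_mul, smul_eq_mul]; ring

/-- Homogeneous combination. -/
def hom {n : ℕ} (R : Finset (Fin n)) (D : ℕ) (c : Finset (Fin n) → ℝ) : Finset (Fin n) → ℝ :=
  ∑ S ∈ R.powersetCard D, c S • xS S

lemma hom_add {n : ℕ} (R : Finset (Fin n)) (D : ℕ) (c c' : Finset (Fin n) → ℝ) :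
    hom R D (c + c') = hom R D c + hom R D c' := by
  simp [hom, add_smul, Finset.sum_add_distrib]

lemma hom_smul {n : ℕ} (R : Finset (Fin n)) (D : ℕ) (a : ℝ) (c : Finset (Fin n) → ℝ) :
    hom R D (a • c) = a • hom R D c := by
  simp [hom, mul_smul, Finset.smul_sum]

lemma hom_mem {n : ℕ} (R : Finset (Fin n)) (D : ℕ) (c : Finset (Fin n) → ℝ) :
    hom R D c ∈ V R D := by
  apply Submodule.sum_mem
  intro S hS
  rw [Finset.mem_powersetCard] at hS
  exact Submodule.smul_mem _ _ (xS_mem hS.1 hS.2.le)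

/-- the property of being homogenizable -/
def Hz {n : ℕ} (κ μ : ℝ) (R : Finset (Fin n)) (D : ℕ) (f : Finset (Fin n) → ℝ) : Prop :=
  ∃ c, ∀ g ∈ V R D, E κ μ R (f * g) = E κ μ R (hom R D c * g)

lemma Hz_add {n : ℕ} {κ μ : ℝ} {R : Finset (Fin n)} {D : ℕ} {f f' : Finset (Fin n) → ℝ}
    (h : Hz κ μ R D f) (h' : Hz κ μ R D f') : Hz κ μ R D (f + f') := by
  obtain ⟨c, hc⟩ := h
  obtain ⟨c', hc'⟩ := h'
  refine ⟨c + c', fun g hg => ?_⟩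
  rw [hom_add, add_mul, add_mul, map_add, map_add, hc g hg, hc' g hg]

lemma Hz_smul {n : ℕ} {κ μ : ℝ} {R : Finset (Fin n)} {D : ℕ} {f : Finset (Fin n) → ℝ} (a : ℝ)
    (h : Hz κ μ R D f) : Hz κ μ R D (a • f) := by
  obtain ⟨c, hc⟩ := h
  refine ⟨a • c, fun g hg => ?_⟩
  rw [hom_smul, smul_mul_assoc, smul_mul_assoc, map_smul, map_smul, hc g hg]

lemma Hz_zero {n : ℕ} {κ μ : ℝ} {R : Finset (Fin n)} {D : ℕ} : Hz κ μ R D 0 := by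
  refine ⟨0, fun g hg => ?_⟩
  simp [hom]

lemma Hz_sum {n : ℕ} {κ μ : ℝ} {R : Finset (Fin n)} {D : ℕ} {ι : Type*} (s : Finset ι)
    (f : ι → Finset (Fin n) → ℝ) (h : ∀ i ∈ s, Hz κ μ R D (f i)) :
    Hz κ μ R D (∑ i ∈ s, f i) := by
  classical
  induction s using Finset.induction_on with
  | empty => simpa using Hz_zero
  | insert i s hi ih =>
    rw [Finset.sum_insert hi]
    exact Hz_add (h i (Finset.mem_insert_self _ _))
      (ih fun j hj => h j (Finset.mem_insert_of_mem hj))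

lemma Hz_xS {n : ℕ} (κ μ : ℝ) (R : Finset (Fin n)) (hm : κ + μ = R.card) (D : ℕ)
    (hD : 2 * D < R.card) (hκ : (D : ℝ) ≤ κ) (e : ℕ) :
    ∀ S ⊆ R, S.card + e = D → Hz κ μ R D (xS S) := by
  induction e with
  | zero =>
    intro S hS hc
    refine ⟨Pi.single S 1, fun g hg => ?_⟩
    congr 2
    unfold hom
    rw [Finset.sum_eq_single S]
    · simp
    · intro T _ hT
      simp [hT]
    · intro h
      exact absurd (Finset.mem_powersetCard.2 ⟨hS, by omega⟩) h
  | succ e ih =>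
    intro S hS hc
    have hlt : (S.card : ℝ) < κ := by
      have : (S.card : ℝ) < D := by exact_mod_cast (by omega : S.card < D)
      linarith
    have hz : Hz κ μ R D ((κ - S.card)⁻¹ • ∑ i ∈ R \ S, xS (insert i S)) := by
      apply Hz_smul
      apply Hz_sum
      intro i hi
      rw [Finset.mem_sdiff] at hi
      apply ih _ (Finset.insert_subset hi.1 hS)
      rw [Finset.card_insert_of_notMem hi.2]
      omega
    obtain ⟨c, hc'⟩ := hz
    refine ⟨c, fun g hg => ?_⟩
    rw [← hc' g hg]
    have h1 := E_constraint κ μ R hm (S.card + D) (by omega) (xS S * g)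
      (V_mul (xS_mem hS le_rfl) hg)
    rw [← mul_assoc, sumX_mul hS, add_mul, map_add, smul_mul_assoc, map_smul, smul_eq_mul] at h1
    rw [smul_mul_assoc, map_smul, smul_eq_mul, eq_inv_mul_iff_mul_eq₀ (by linarith)]
    linarith

lemma Hz_V {n : ℕ} (κ μ : ℝ) (R : Finset (Fin n)) (hm : κ + μ = R.card) (D : ℕ)
    (hD : 2 * D < R.card) (hκ : (D : ℝ) ≤ κ) (f : Finset (Fin n) → ℝ) (hf : f ∈ V R D) :
    Hz κ μ R D f := by
  unfold V at hf
  induction hf using Submodule.span_induction with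
  | mem f hf =>
    obtain ⟨S, hS, hc, rfl⟩ := hf
    exact Hz_xS κ μ R hm D hD hκ (D - S.card) S hS (by omega)
  | zero => exact Hz_zero
  | add x y _ _ hx hy => exact Hz_add hx hy
  | smul c x _ hx => exact Hz_smul c hx

lemma E_hom_sq {n : ℕ} (κ μ : ℝ) (R : Finset (Fin n)) (hm : κ + μ = R.card) (D : ℕ)
    (hD : 2 * D < R.card) (hκ : (2 * D : ℝ) ≤ κ) (hμ : (D : ℝ) ≤ μ) (c : Finset (Fin n) → ℝ) :
    0 ≤ E κ μ R (hom R D c * hom R D c) := by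
  have key : E κ μ R (hom R D c * hom R D c) =
      ∑ J ∈ R.powerset, Phi κ μ (2 * D - J.card) J.card *
        (∑ S ∈ R.powersetCard D, if J ⊆ S then c S else 0) ^ 2 := by
    unfold hom
    rw [Finset.sum_mul_sum, map_sum]
    simp_rw [map_sum, sq, Finset.sum_mul_sum, Finset.mul_sum]
    rw [Finset.sum_comm]
    rw [Finset.sum_comm (s := R.powerset)]
    rw [Finset.sum_comm]
    apply Finset.sum_congr rfl
    intro S hS
    rw [Finset.sum_comm]
    apply Finset.sum_congr rfl
    intro T hT
    rw [Finset.mem_powersetCard] at hS hT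
    rw [smul_mul_smul_comm, xS_mul, map_smul, E_xS κ μ R hm _ (Finset.union_subset hS.1 hT.1)]
    have hui := Finset.card_union_add_card_inter S T
    have hil : (S ∩ T).card ≤ D := hS.2 ▸ Finset.card_le_card Finset.inter_subset_left
    rw [← Phi_sum κ μ R.card hm (S ∩ T) (S ∪ T).card 0 (by omega)]
    have hfil : (S ∩ T).powerset = R.powerset.filter (fun J => J ⊆ S ∧ J ⊆ T) := by
      ext J
      simp only [Finset.mem_filter, Finset.mem_powerset, Finset.subset_inter_iff]
      exact ⟨fun h => ⟨h.1.trans hS.1, h⟩, fun h => h.2⟩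
    rw [hfil, Finset.sum_filter, smul_eq_mul, Finset.mul_sum]
    apply Finset.sum_congr rfl
    intro J hJ
    have : (S ∪ T).card + (S ∩ T).card - J.card = 2 * D - J.card := by omega
    rw [this, zero_add]
    by_cases h1 : J ⊆ S <;> by_cases h2 : J ⊆ T <;> simp [h1, h2]
    ring
  rw [key]
  apply Finset.sum_nonneg
  intro J hJ
  by_cases hJD : J.card ≤ D
  · apply mul_nonneg _ (sq_nonneg _)
    apply Phi_nonneg κ μ R.card hm
    · omega
    · have : ((2 * D - J.card : ℕ) : ℝ) ≤ ((2 * D : ℕ) : ℝ) := by exact_mod_cast Nat.sub_le _ _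
      push_cast at this
      linarith
    · have : (J.card : ℝ) ≤ D := by exact_mod_cast hJD
      linarith
  · have : (∑ S ∈ R.powersetCard D, if J ⊆ S then c S else 0) = 0 := by
      apply Finset.sum_eq_zero
      intro S hS
      rw [Finset.mem_powersetCard] at hS
      rw [if_neg]
      intro h
      have := Finset.card_le_card h
      omega
    rw [this]
    simp

lemma E_sq {n : ℕ} (κ μ : ℝ) (R : Finset (Fin n)) (hm : κ + μ = R.card) (D : ℕ)
    (hD : 2 * D < R.card) (hκ : (2 * D : ℝ) ≤ κ) (hμ : (D : ℝ) ≤ μ)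
    (f : Finset (Fin n) → ℝ) (hf : f ∈ V R D) : 0 ≤ E κ μ R (f * f) := by
  have hD0 : (0 : ℝ) ≤ D := by positivity
  obtain ⟨c, hc⟩ := Hz_V κ μ R hm D hD (by linarith) f hf
  rw [hc f hf, mul_comm, hc _ (hom_mem R D c)]
  exact E_hom_sq κ μ R hm D hD hκ hμ c

/-- Hitting set lemma. -/
lemma hitting {ι : Type*} {n : ℕ} (hn : 0 < n) (P : ι → Finset (Fin n)) (d : ℕ) (hd : d ≤ n)
    (b : ℕ) : ∀ W : Finset ι, (∀ w ∈ W, d ≤ (P w).card) →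
      (W.card : ℝ) * (1 - d / n) ^ b < 1 →
      ∃ H : Finset (Fin n), H.card ≤ b ∧ ∀ w ∈ W, ¬ Disjoint (P w) H := by
  classical
  have hnR : (0 : ℝ) < n := by exact_mod_cast hn
  induction b with
  | zero =>
    intro W _ h
    have : W.card = 0 := by
      simp only [pow_zero, mul_one] at h
      have : W.card < 1 := by exact_mod_cast h
      omega
    rw [Finset.card_eq_zero] at this
    subst this
    exact ⟨∅, by simp, by simp⟩
  | succ b ih =>
    intro W hW h
    have hex : ∃ i : Fin n, (W.card : ℝ) * d / n ≤ ((W.filter fun w => i ∈ P w).card : ℝ) := by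
      by_contra hcon
      push Not at hcon
      have hne : (Finset.univ : Finset (Fin n)).Nonempty := ⟨⟨0, hn⟩, Finset.mem_univ _⟩
      have h1 := Finset.sum_lt_sum_of_nonempty hne fun i _ => hcon i
      have h2 : ∑ i : Fin n, (W.filter fun w => i ∈ P w).card = ∑ w ∈ W, (P w).card := by
        simp_rw [Finset.card_filter]
        rw [Finset.sum_comm]
        apply Finset.sum_congr rfl
        intro w _
        rw [← Finset.card_filter]
        simp
      have h3 : W.card * d ≤ ∑ w ∈ W, (P w).card := by
        rw [← smul_eq_mul, ← Finset.sum_const]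
        exact Finset.sum_le_sum hW
      rw [Finset.sum_const, Finset.card_univ, Fintype.card_fin, nsmul_eq_mul,
        mul_div_cancel₀ _ hnR.ne'] at h1
      have h4 : ((∑ i : Fin n, (W.filter fun w => i ∈ P w).card : ℕ) : ℝ) < W.card * d := by
        push_cast
        exact h1
      rw [h2] at h4
      have h5 : ∑ w ∈ W, (P w).card < W.card * d := by exact_mod_cast h4
      omega
    obtain ⟨i, hi⟩ := hex
    have hcard := Finset.card_filter_add_card_filter_not (s := W) (fun w => i ∈ P w)
    have hcardR : ((W.filter fun w => i ∈ P w).card : ℝ) +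
        ((W.filter fun w => ¬ i ∈ P w).card : ℝ) = W.card := by exact_mod_cast hcard
    have hdn : (0 : ℝ) ≤ 1 - d / n := by
      rw [sub_nonneg, div_le_one hnR]
      exact_mod_cast hd
    have hle : ((W.filter fun w => ¬ i ∈ P w).card : ℝ) ≤ W.card * (1 - d / n) := by
      have : (W.card : ℝ) * (1 - d / n) = W.card - W.card * d / n := by ring
      rw [this]
      linarith
    obtain ⟨H, hH, hH'⟩ := ih (W.filter fun w => ¬ i ∈ P w)
      (fun w hw => hW w (Finset.mem_filter.1 hw).1) (by
        refine lt_of_le_of_lt (mul_le_mul_of_nonneg_right hle (pow_nonneg hdn b)) ?_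
        rw [mul_assoc, ← pow_succ']
        exact h)
    refine ⟨insert i H, (Finset.card_insert_le _ _).trans (by omega), fun w hw => ?_⟩
    rw [Finset.disjoint_insert_right]
    by_cases hiw : i ∈ P w
    · exact fun h => h.1 hiw
    · exact fun h => hH' w (Finset.mem_filter.2 ⟨hw, hiw⟩) h.2

/-- The Boolean point with zero set `Z`. -/
def pt {n : ℕ} (Z : Finset (Fin n)) : Fin n ⊕ Fin n → ℝ :=
  Sum.elim (fun i => if i ∈ Z then 0 else 1) (fun i => if i ∈ Z then 1 else 0)

lemma pt_nonneg {n : ℕ} (Z : Finset (Fin n)) (v) : 0 ≤ pt Z v := by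
  rcases v with i | i <;> simp only [pt, Sum.elim_inl, Sum.elim_inr] <;> split_ifs <;> simp

lemma eval_boolAxiom {n : ℕ} (Z : Finset (Fin n)) (a : Fin 3 × Fin n) :
    eval (pt Z) (boolAxiom n a) = 0 := by
  unfold boolAxiom
  split_ifs <;> by_cases h : a.2 ∈ Z <;> simp [pt, h]

lemma eval_knap {n : ℕ} (k : ℕ) (Z : Finset (Fin n)) :
    eval (pt Z) (knapsackPoly n k) = 2 * (n - Z.card) - k := by
  have : ∑ i : Fin n, (if i ∈ Z then (0 : ℝ) else 1) = n - Z.card := by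
    have h : ∀ i : Fin n, (if i ∈ Z then (0 : ℝ) else 1) = 1 - (if i ∈ Z then 1 else 0) := by
      intro i; split_ifs <;> simp
    simp_rw [h]
    rw [Finset.sum_sub_distrib]
    simp
  simp [knapsackPoly, pt, this]

lemma eval_identity {n k : ℕ} (π : PSProof n 0 1 (fun j : Fin 0 => j.elim0)
          (fun _ : Fin 1 => knapsackPoly n k) (-1)) (Z : Finset (Fin n)) :
    (-1 : ℝ) = (π.r0.map fun r => eval (pt Z) r * eval (pt Z) r).sum
      + eval (pt Z) (π.t 0) * (2 * (n - Z.card) - k) := by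
  have h := congrArg (eval (pt Z)) π.identity
  have hJs : π.Js = ∅ := by
    rw [Finset.eq_empty_iff_forall_notMem]
    intro J hJ
    have : J = ∅ := Subsingleton.elim _ _
    exact π.empty_not_mem (this ▸ hJ)
  rw [hJs] at h
  simp only [map_neg, map_one, map_add, map_sum, map_mul, eval_boolAxiom, eval_knap,
    Finset.sum_empty, mul_zero, Finset.sum_const_zero, add_zero, Fin.sum_univ_one,
    sosOf, map_list_sum, List.map_map] at h
  rw [h]
  congr 3
  funext r
  simp [sq]

lemma two_le {n k : ℕ} (hk : 1 ≤ k) (hkn : k ≤ n) (π : PSProof n 0 1 (fun j : Fin 0 => j.elim0)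
          (fun _ : Fin 1 => knapsackPoly n k) (-1)) : 2 ≤ π.size := by
  have hsz : (π.t 0).support.card ≤ π.size := by
    unfold PSProof.size
    rw [Fin.sum_univ_one]
    omega
  by_contra hlt
  have h1 : (π.t 0).support.card ≤ 1 := by omega
  obtain ⟨w, c, hw⟩ : ∃ w c, π.t 0 = monomial w c := by
    obtain ⟨w, c, hw⟩ := Finsupp.card_support_le_one'.1 h1
    refine ⟨w, c, MvPolynomial.ext _ _ fun m => ?_⟩
    rw [coeff_monomial, ← Finsupp.single_apply, ← hw]
    rfl
  have hsum : ∀ Z : Finset (Fin n),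
      0 ≤ (π.r0.map fun r => eval (pt Z) r * eval (pt Z) r).sum := by
    intro Z
    apply List.sum_nonneg
    intro x hx
    obtain ⟨r, _, rfl⟩ := List.mem_map.1 hx
    exact mul_self_nonneg _
  have hp : ∀ Z : Finset (Fin n), 0 ≤ w.prod fun i e => pt Z i ^ e := by
    intro Z
    exact Finset.prod_nonneg fun i _ => pow_nonneg (pt_nonneg Z i) _
  have e1 := eval_identity π ∅
  have e2 := eval_identity π Finset.univ
  rw [hw, eval_monomial] at e1 e2
  have s1 := hsum ∅
  have s2 := hsum Finset.univ
  have p1 := hp ∅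
  have p2 := hp Finset.univ
  have hkR : (1 : ℝ) ≤ k := by exact_mod_cast hk
  have hnR : (k : ℝ) ≤ n := by exact_mod_cast hkn
  simp only [Finset.card_empty, Finset.card_univ, Fintype.card_fin, Nat.cast_zero, sub_zero,
    sub_self, mul_zero, zero_sub] at e1 e2
  rcases le_total 0 c with hc | hc
  · have : 0 ≤ c * (w.prod fun i e => pt ∅ i ^ e) * (2 * (n : ℝ) - k) :=
      mul_nonneg (mul_nonneg hc p1) (by linarith)
    linarith
  · have : 0 ≤ (-c) * (w.prod fun i e => pt Finset.univ i ^ e) * (k : ℝ) :=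
      mul_nonneg (mul_nonneg (by linarith) p2) (by linarith)
    linarith

/-- positive and negative parts of a monomial -/
def pos {n : ℕ} (w : Fin n ⊕ Fin n →₀ ℕ) : Finset (Fin n) :=
  Finset.univ.filter fun i => w (Sum.inl i) ≠ 0
def neg {n : ℕ} (w : Fin n ⊕ Fin n →₀ ℕ) : Finset (Fin n) :=
  Finset.univ.filter fun i => w (Sum.inr i) ≠ 0

/-- junta -/
def gJ {n : ℕ} (P Q : Finset (Fin n)) : Finset (Fin n) → ℝ :=
  fun J => if Disjoint P J ∧ Q ⊆ J then 1 else 0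

lemma prod_pt {n : ℕ} (w : Fin n ⊕ Fin n →₀ ℕ) (Z : Finset (Fin n)) :
    ∏ v, pt Z v ^ w v = gJ (pos w) (neg w) Z := by
  unfold gJ
  split_ifs with h
  · apply Finset.prod_eq_one
    intro v _
    by_cases hv : w v = 0
    · simp [hv]
    rcases v with i | i
    · have : i ∈ pos w := by simp [pos, hv]
      have : i ∉ Z := Finset.disjoint_left.1 h.1 this
      simp [pt, this]
    · have : i ∈ neg w := by simp [neg, hv]
      have : i ∈ Z := h.2 this
      simp [pt, this]
  · by_cases hP : Disjoint (pos w) Z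
    · have hQ : ¬ neg w ⊆ Z := fun h' => h ⟨hP, h'⟩
      obtain ⟨i, hi, hiZ⟩ := Finset.not_subset.1 hQ
      apply Finset.prod_eq_zero (Finset.mem_univ (Sum.inr i))
      have : w (Sum.inr i) ≠ 0 := by simpa [neg] using hi
      simp [pt, hiZ, this]
    · obtain ⟨i, hi, hiZ⟩ := Finset.not_disjoint_iff.1 hP
      apply Finset.prod_eq_zero (Finset.mem_univ (Sum.inl i))
      have : w (Sum.inl i) ≠ 0 := by simpa [pos] using hi
      simp [pt, hiZ, this]

lemma gJ_mem {n : ℕ} {R : Finset (Fin n)} (Q : Finset (Fin n)) (hQ : Q ⊆ R) :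
    ∀ P ⊆ R, gJ P Q ∈ V R (P.card + Q.card) := by
  induction Q using Finset.induction_on with
  | empty =>
    intro P hP
    have : gJ P ∅ = xS P := by funext J; simp [gJ, xS]
    rw [this]
    exact xS_mem hP (by simp)
  | insert i Q hi ih =>
    intro P hP
    have hiR : i ∈ R := hQ (Finset.mem_insert_self _ _)
    have hQR : Q ⊆ R := fun x hx => hQ (Finset.mem_insert_of_mem hx)
    have : gJ P (insert i Q) = gJ P Q - gJ (insert i P) Q := by
      funext J
      simp only [gJ, Pi.sub_apply, Finset.disjoint_insert_left, Finset.insert_subset_iff]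
      by_cases h1 : i ∈ J <;> by_cases h2 : Disjoint P J <;> by_cases h3 : Q ⊆ J <;>
        simp [h1, h2, h3]
    rw [this, Finset.card_insert_of_notMem hi]
    apply Submodule.sub_mem
    · exact V_mono (by omega) (ih hQR P hP)
    · refine V_mono ?_ (ih hQR _ (Finset.insert_subset hiR hP))
      have := Finset.card_insert_le i P
      omega

lemma restr_mem {n : ℕ} (A B : Finset (Fin n)) (hAB : Disjoint A B) (P Q : Finset (Fin n)) (D : ℕ)
    (h : ¬ Disjoint P B ∨ ¬ Disjoint Q A ∨ P.card + (Q \ B).card ≤ D) :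
    (fun J => gJ P Q (B ∪ (J ∩ (A ∪ B)ᶜ))) ∈ V (A ∪ B)ᶜ D := by
  by_cases hP : Disjoint P B
  swap
  · convert Submodule.zero_mem _ using 1
    funext J
    simp only [gJ, Pi.zero_apply]
    rw [if_neg]
    rintro ⟨h1, _⟩
    exact hP (Finset.disjoint_union_right.1 h1).1
  by_cases hQ : Disjoint Q A
  swap
  · convert Submodule.zero_mem _ using 1
    funext J
    simp only [gJ, Pi.zero_apply]
    rw [if_neg]
    rintro ⟨_, h1⟩
    obtain ⟨i, hi, hiA⟩ := Finset.not_disjoint_iff.1 hQ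
    have h2 := h1 hi
    have h3 := Finset.disjoint_left.1 hAB hiA
    simp [hiA, h3] at h2
  have hc : P.card + (Q \ B).card ≤ D := by tauto
  have hP' : (P \ A) ⊆ (A ∪ B)ᶜ := by
    intro i hi
    have h2 := Finset.mem_sdiff.1 hi
    have h3 := Finset.disjoint_left.1 hP h2.1
    simp [h2.2, h3]
  have hQ' : (Q \ B) ⊆ (A ∪ B)ᶜ := by
    intro i hi
    have h2 := Finset.mem_sdiff.1 hi
    have h3 := Finset.disjoint_left.1 hQ h2.1
    simp [h2.2, h3]
  have : (fun J => gJ P Q (B ∪ (J ∩ (A ∪ B)ᶜ))) = gJ (P \ A) (Q \ B) := by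
    funext J
    unfold gJ
    congr 1
    apply propext
    apply and_congr
    · simp only [Finset.disjoint_left, Finset.mem_union, Finset.mem_inter, Finset.mem_compl,
        Finset.mem_sdiff] at *
      constructor
      · intro h1 i hi hJ
        have := h1 hi.1
        have := hP hi.1
        tauto
      · intro h1 i hi hJ
        have := hP hi
        have := @h1 i
        tauto
    · simp only [Finset.subset_iff, Finset.disjoint_left, Finset.mem_union, Finset.mem_inter,
        Finset.mem_compl, Finset.mem_sdiff] at *
      constructor
      · intro h1 i hi
        have := h1 hi.1
        tauto
      · intro h1 i hi
        have := hQ hi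
        have := @h1 i
        tauto
  rw [this]
  refine V_mono ?_ (gJ_mem _ hQ' _ hP')
  have := Finset.card_le_card (Finset.sdiff_subset : P \ A ⊆ P)
  omega

lemma eval_mem {n : ℕ} (A B : Finset (Fin n)) (hAB : Disjoint A B) (D : ℕ) (p : MvPoly n)
    (h : ∀ w ∈ p.support, ¬ Disjoint (pos w) B ∨ ¬ Disjoint (neg w) A ∨
      (pos w).card + (neg w \ B).card ≤ D) :
    (fun J => eval (pt (B ∪ (J ∩ (A ∪ B)ᶜ))) p) ∈ V (A ∪ B)ᶜ D := by
  have : (fun J => eval (pt (B ∪ (J ∩ (A ∪ B)ᶜ))) p) =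
      ∑ w ∈ p.support, p.coeff w • (fun J => gJ (pos w) (neg w) (B ∪ (J ∩ (A ∪ B)ᶜ))) := by
    funext J
    rw [eval_eq', Finset.sum_apply]
    simp only [Pi.smul_apply, smul_eq_mul, prod_pt]
  rw [this]
  apply Submodule.sum_mem
  intro w hw
  exact Submodule.smul_mem _ _ (restr_mem A B hAB _ _ D (h w hw))

lemma list_supp {n : ℕ} (l : List (MvPoly n)) : ∃ W : Finset (Fin n ⊕ Fin n →₀ ℕ),
    W.card ≤ (l.map fun r => r.support.card).sum ∧ ∀ r ∈ l, r.support ⊆ W := by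
  classical
  induction l with
  | nil => exact ⟨∅, by simp, by simp⟩
  | cons p l ih =>
    obtain ⟨W, hW, hW'⟩ := ih
    refine ⟨p.support ∪ W, ?_, ?_⟩
    · rw [List.map_cons, List.sum_cons]
      exact (Finset.card_union_le _ _).trans (by omega)
    · intro r hr
      rcases List.mem_cons.1 hr with rfl | hr
      · exact Finset.subset_union_left
      · exact (hW' r hr).trans Finset.subset_union_right

lemma sumX_apply {n : ℕ} (R J : Finset (Fin n)) (hJ : J ⊆ R) :
    sumX R J = (R.card : ℝ) - J.card := by
  unfold sumX
  rw [Finset.sum_apply]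
  simp only [xS, Finset.disjoint_singleton_left]
  rw [← Finset.sum_filter, Finset.sum_const, nsmul_eq_mul, mul_one]
  have : R.filter (fun i => i ∉ J) = R \ J := by ext; simp
  rw [this, ← Finset.card_sdiff_add_card_eq_card hJ]
  push_cast
  ring

lemma E_congr {n : ℕ} (κ μ : ℝ) (R : Finset (Fin n)) (F G : Finset (Fin n) → ℝ)
    (h : ∀ J ⊆ R, F J = G J) : E κ μ R F = E κ μ R G := by
  apply Finset.sum_congr rfl
  intro J hJ
  rw [h J (Finset.mem_powerset.1 hJ)]

lemma main {n k : ℕ} (q : ℕ) (hq : 1 ≤ q) (hqk : 16 * q ≤ k) (hkn : k ≤ n)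
    (π : PSProof n 0 1 (fun j : Fin 0 => j.elim0)
          (fun _ : Fin 1 => knapsackPoly n k) (-1)) :
    1 ≤ (π.size : ℝ) * (1 - q / n) ^ q := by
  classical
  by_contra hlt
  push Not at hlt
  have hn : 0 < n := by omega
  have hnR : (0 : ℝ) < n := by exact_mod_cast hn
  have hqn : (0 : ℝ) ≤ (1 - q / n) ^ q := by
    apply pow_nonneg
    rw [sub_nonneg, div_le_one hnR]
    exact_mod_cast (by omega : q ≤ n)
  obtain ⟨W0, hW0, hW0'⟩ := list_supp π.r0
  obtain ⟨W, hWc, hWr, hWt⟩ : ∃ W : Finset (Fin n ⊕ Fin n →₀ ℕ), W.card ≤ π.size ∧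
      (∀ r ∈ π.r0, r.support ⊆ W) ∧ (π.t 0).support ⊆ W := by
    refine ⟨W0 ∪ (π.t 0).support, ?_, ?_, Finset.subset_union_right⟩
    · refine (Finset.card_union_le _ _).trans ?_
      unfold PSProof.size
      rw [Fin.sum_univ_one]
      omega
    · intro r hr
      exact (hW0' r hr).trans Finset.subset_union_left
  have hsub : ∀ W' ⊆ W, (W'.card : ℝ) * (1 - q / n) ^ q < 1 := by
    intro W' hW'
    refine lt_of_le_of_lt (mul_le_mul_of_nonneg_right ?_ hqn) hlt
    exact_mod_cast (Finset.card_le_card hW').trans hWc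
  obtain ⟨B, hBc, hB⟩ := hitting hn pos q (by omega) q (W.filter fun w => q ≤ (pos w).card)
    (fun w hw => (Finset.mem_filter.1 hw).2) (hsub _ (Finset.filter_subset _ _))
  obtain ⟨A', hAc', hA'⟩ := hitting hn (fun w => neg w \ B) q (by omega) q
    (W.filter fun w => q ≤ (neg w \ B).card)
    (fun w hw => (Finset.mem_filter.1 hw).2) (hsub _ (Finset.filter_subset _ _))
  obtain ⟨A, hA⟩ : ∃ A, A = A' \ B := ⟨_, rfl⟩
  have hAc : A.card ≤ q := by
    rw [hA]; exact (Finset.card_le_card Finset.sdiff_subset).trans hAc'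
  have hAB : Disjoint A B := by rw [hA]; exact Finset.sdiff_disjoint
  have hW : ∀ w ∈ W, ¬ Disjoint (pos w) B ∨ ¬ Disjoint (neg w) A ∨
      (pos w).card + (neg w \ B).card ≤ 2 * q := by
    intro w hw
    by_cases h1 : q ≤ (pos w).card
    · exact Or.inl (hB w (Finset.mem_filter.2 ⟨hw, h1⟩))
    by_cases h2 : q ≤ (neg w \ B).card
    · right; left
      have h3 := hA' w (Finset.mem_filter.2 ⟨hw, h2⟩)
      obtain ⟨i, hi, hiA⟩ := Finset.not_disjoint_iff.1 h3
      rw [Finset.mem_sdiff] at hi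
      exact Finset.not_disjoint_iff.2 ⟨i, hi.1, by rw [hA]; exact Finset.mem_sdiff.2 ⟨hiA, hi.2⟩⟩
    · right; right; omega
  obtain ⟨R, hR⟩ : ∃ R, R = (A ∪ B)ᶜ := ⟨_, rfl⟩
  have hRc : R.card + A.card + B.card = n := by
    have h1 := Finset.card_add_card_compl (A ∪ B)
    rw [← hR, Finset.card_union_of_disjoint hAB, Fintype.card_fin] at h1
    omega
  have hRcR : (R.card : ℝ) + A.card + B.card = n := by exact_mod_cast hRc
  have hAcR : (A.card : ℝ) ≤ q := by exact_mod_cast hAc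
  have hBcR : (B.card : ℝ) ≤ q := by exact_mod_cast hBc
  have hqkR : 16 * (q : ℝ) ≤ k := by exact_mod_cast hqk
  have hknR : (k : ℝ) ≤ n := by exact_mod_cast hkn
  have hqR : (1 : ℝ) ≤ q := by exact_mod_cast hq
  obtain ⟨κ, hκ⟩ : ∃ κ : ℝ, κ = k / 2 - A.card := ⟨_, rfl⟩
  obtain ⟨μ, hμ⟩ : ∃ μ : ℝ, μ = R.card - κ := ⟨_, rfl⟩
  have hm : κ + μ = R.card := by rw [hμ]; ring
  obtain ⟨ev, hev⟩ : ∃ ev : MvPoly n → Finset (Fin n) → ℝ,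
    ev = fun p J => eval (pt (B ∪ (J ∩ (A ∪ B)ᶜ))) p := ⟨_, rfl⟩
  have hmem : ∀ p : MvPoly n, p.support ⊆ W → ev p ∈ V R (2 * q) := by
    intro p hp
    rw [hR, hev]
    exact eval_mem A B hAB (2 * q) p fun w hw => hW w (hp hw)
  have hid : E κ μ R (-(xS ∅)) = E κ μ R ((π.r0.map fun r => ev r * ev r).sum
      + ((2 : ℝ) • (sumX R * ev (π.t 0)) - (2 * κ) • ev (π.t 0))) := by
    apply E_congr
    intro J hJ
    have h1 := eval_identity π (B ∪ (J ∩ (A ∪ B)ᶜ))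
    have hJB : (B ∪ (J ∩ (A ∪ B)ᶜ)).card = B.card + J.card := by
      rw [← hR, Finset.inter_eq_left.2 hJ, Finset.card_union_of_disjoint]
      rw [Finset.disjoint_left]
      intro i hi hiJ
      have h2 := hJ hiJ
      rw [hR] at h2
      simp [hi] at h2
    rw [hJB] at h1
    have h2 : (π.r0.map fun r => ev r * ev r).sum J =
        (π.r0.map fun r => eval (pt (B ∪ (J ∩ (A ∪ B)ᶜ))) r *
          eval (pt (B ∪ (J ∩ (A ∪ B)ᶜ))) r).sum := by
      have h3 := map_list_sum (Pi.evalAddMonoidHom (fun _ : Finset (Fin n) => ℝ) J)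
        (π.r0.map fun r => ev r * ev r)
      rw [List.map_map] at h3
      simp only [Pi.evalAddMonoidHom_apply] at h3
      rw [h3, hev]
      rfl
    simp only [Pi.neg_apply, Pi.add_apply, Pi.sub_apply, Pi.smul_apply, Pi.mul_apply, smul_eq_mul]
    rw [h2, sumX_apply R J hJ]
    have h4 : xS ∅ J = 1 := by simp [xS]
    rw [h4, h1]
    have h5 : ev (π.t 0) J = eval (pt (B ∪ (J ∩ (A ∪ B)ᶜ))) (π.t 0) := by rw [hev]
    rw [h5, ← hRcR, hκ]
    push_cast
    ring
  have hsq : 0 ≤ E κ μ R (π.r0.map fun r => ev r * ev r).sum := by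
    rw [map_list_sum]
    apply List.sum_nonneg
    intro x hx
    rw [List.map_map] at hx
    obtain ⟨r, hr, rfl⟩ := List.mem_map.1 hx
    refine E_sq κ μ R hm (2 * q) (by omega) ?_ ?_ _ (hmem r (hWr r hr))
    · push_cast
      rw [hκ]
      linarith
    · push_cast
      rw [hμ, hκ]
      linarith
  have hcon := E_constraint κ μ R hm (2 * q) (by omega) _ (hmem (π.t 0) hWt)
  rw [map_neg, map_add, map_sub, map_smul, map_smul, hcon, E_xS κ μ R hm ∅ (Finset.empty_subset _)]
    at hid
  have hPhi : Phi κ μ 0 0 = 1 := by simp [Phi]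
  rw [Finset.card_empty, hPhi, smul_eq_mul, smul_eq_mul] at hid
  linarith

end KS

/-- **Corollary (SOS size lower bound for Knapsack).** There is `ε > 0` such that
for every sufficiently large `n` and every `k ∈ [n]`, every SOS refutation of
`KS_{n,k}` has monomial size at least `2^{ε·k²/n}`.  (An SOS refutation is a PS
refutation of a system with no inequality constraints.) -/
theorem statement18 :
    ∃ ε : ℝ, 0 < ε ∧ ∃ N : ℕ, ∀ n : ℕ, N ≤ n → ∀ k : ℕ, 1 ≤ k → k ≤ n →
      ∀ π : PSProof n 0 1 (fun j : Fin 0 => j.elim0)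
          (fun _ : Fin 1 => knapsackPoly n k) (-1),
        (2 : ℝ) ^ (ε * (k : ℝ) ^ 2 / (n : ℝ)) ≤ (π.size : ℝ) := by
  refine ⟨1 / 1024, by norm_num, 1, fun n hn k hk hkn π => ?_⟩
  have hnR : (1 : ℝ) ≤ n := by exact_mod_cast hn
  have hn0 : (0 : ℝ) < n := by linarith
  have hkR : (1 : ℝ) ≤ k := by exact_mod_cast hk
  have hknR : (k : ℝ) ≤ n := by exact_mod_cast hkn
  by_cases hk16 : k < 16
  · have h2 : (2 : ℝ) ≤ π.size := by exact_mod_cast KS.two_le hk hkn π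
    refine le_trans ?_ h2
    have hk16R : (k : ℝ) < 16 := by exact_mod_cast hk16
    calc (2 : ℝ) ^ (1 / 1024 * (k : ℝ) ^ 2 / (n : ℝ)) ≤ (2 : ℝ) ^ (1 : ℝ) := by
          apply Real.rpow_le_rpow_of_exponent_le (by norm_num)
          rw [div_le_one hn0]
          nlinarith
      _ = 2 := by simp
  · obtain ⟨q, hq⟩ : ∃ q, q = k / 16 := ⟨_, rfl⟩
    have hq1 : 1 ≤ q := by omega
    have hqk : 16 * q ≤ k := by omega
    have hkq : k ≤ 32 * q := by omega
    have h := KS.main q hq1 hqk hkn π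
    have hkqR : (k : ℝ) ≤ 32 * q := by exact_mod_cast hkq
    have hqn : (0 : ℝ) ≤ 1 - q / n := by
      rw [sub_nonneg, div_le_one hn0]
      exact_mod_cast (by omega : q ≤ n)
    have hexp : (1 - (q : ℝ) / n) ^ q ≤ Real.exp (-((q : ℝ) ^ 2 / n)) := by
      calc (1 - (q : ℝ) / n) ^ q ≤ (Real.exp (-((q : ℝ) / n))) ^ q := by
            apply pow_le_pow_left₀ hqn
            have := Real.add_one_le_exp (-((q : ℝ) / n))
            linarith
        _ = Real.exp (-((q : ℝ) ^ 2 / n)) := by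
            rw [← Real.exp_nat_mul]
            congr 1
            ring
    have h1 : 1 ≤ (π.size : ℝ) * Real.exp (-((q : ℝ) ^ 2 / n)) :=
      h.trans (mul_le_mul_of_nonneg_left hexp (Nat.cast_nonneg _))
    have h2 : Real.exp ((q : ℝ) ^ 2 / n) ≤ π.size := by
      rw [Real.exp_neg, ← div_eq_mul_inv, le_div_iff₀ (Real.exp_pos _), one_mul] at h1
      exact h1
    refine le_trans ?_ h2
    rw [Real.rpow_def_of_pos (by norm_num)]
    apply Real.exp_le_exp.2
    have hlog : Real.log 2 ≤ 1 := by
      have := Real.log_two_lt_d9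
      linarith
    have hnn : 0 ≤ 1 / 1024 * (k : ℝ) ^ 2 / (n : ℝ) := by positivity
    calc Real.log 2 * (1 / 1024 * (k : ℝ) ^ 2 / (n : ℝ)) ≤ 1 * (1 / 1024 * (k : ℝ) ^ 2 / (n : ℝ)) :=
          mul_le_mul_of_nonneg_right hlog hnn
      _ ≤ (q : ℝ) ^ 2 / n := by
          rw [one_mul]
          apply div_le_div_of_nonneg_right _ hn0.le
          nlinarith
end
end
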